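/- arXiv:1603.06685 — 5 statements merged into one kernel-verified Lean document; each statement's English description precedes it below -/
import Mathlib

section
/- Let d ≥ 1 and let q : [-π,π]^d → ℂ^d be defined by q_i(p) = e^{i p_i} − 1, and for a multiindex α ∈ ℕ₀^d write q(p)^α = ∏_{i=1}^d q_i(p)^{α_i}. Let 𝓜 ⊂ ℕ₀^d \ {0} be a finite set of multiindices containing all multiindices of order 1, let R = max_{α∈𝓜} |α|_∞, and let G = (ℝ^m)^𝓜. Let A : G → G be a symmetric linear map with matrix blocks A_{αβ} ∈ ℝ^{m×m}, operator norm ‖A‖ ≤ Ω₀, and quadratic form satisfying (z, Az) ≥ ω₀ |z^∇|² for all z ∈ G, where z^∇ denotes the restriction of z to the components α = e_1,…,e_d. Define the Hermitian matrix symbol Â(p) = Σ_{α,β∈𝓜} \overline{q(p)}^α A_{αβ} q(p)^β ∈ ℂ^{m×m}. Then for every p ∈ [-π,π]^d one has the operator-norm bound ‖Â(p)‖ ≤ Ω₀ |𝓜| (dπ²)^{dR} |p|², and the lower bound Â(p) ≥ (4ω₀/π²) |p|² · Id in the sense of Hermitian matrices, i.e. a·Â(p)a ≥ (4ω₀/π²)|p|²|a|²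 for all a ∈ ℝ^m. -/
open Matrix Complex
open scoped Matrix BigOperators

/-- The discrete symbol `q_i(p) = e^{ip_i} − 1`. -/
noncomputable def qsym {d : ℕ} (p : Fin d → ℝ) (i : Fin d) : ℂ :=
  Complex.exp (Complex.I * p i) - 1

/-- `q(p)^α = ∏ᵢ q_i(p)^{α_i}` for a multiindex `α`. -/
noncomputable def qpow {d : ℕ} (p : Fin d → ℝ) (α : Fin d → ℕ) : ℂ :=
  ∏ i, qsym p i ^ α i

/-- The Fourier symbol `Â(p) = Σ_{α,β∈𝓜} conj(q(p)^α) A_{αβ} q(p)^β` of the elliptic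
difference operator generated by `A`. -/
noncomputable def Ahat {d m : ℕ} (𝓜 : Finset (Fin d → ℕ))
    (A : ({α // α ∈ 𝓜} × Fin m) → ({α // α ∈ 𝓜} × Fin m) → ℝ) (p : Fin d → ℝ) :
    Matrix (Fin m) (Fin m) ℂ :=
  ∑ α : {α // α ∈ 𝓜}, ∑ β : {α // α ∈ 𝓜},
    (starRingEnd ℂ (qpow p α.1) * qpow p β.1) •
      Matrix.of fun r s : Fin m => (A (α, r) (β, s) : ℂ)

lemma norm_qsym_sq_le {d : ℕ} (p : Fin d → ℝ) (i : Fin d) :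
    ‖qsym p i‖ ^ 2 ≤ p i ^ 2 := by
  rw [← sq_abs (p i), ← Real.norm_eq_abs]
  exact pow_le_pow_left₀ (norm_nonneg _) (Real.norm_exp_I_mul_ofReal_sub_one_le) 2

lemma le_norm_qsym_sq {d : ℕ} (p : Fin d → ℝ) (i : Fin d)
    (hp : p i ∈ Set.Icc (-Real.pi) Real.pi) :
    4 / Real.pi ^ 2 * p i ^ 2 ≤ ‖qsym p i‖ ^ 2 := by
  have h : 2 / Real.pi * |p i / 2| ≤ |Real.sin (p i / 2)| := by
    refine Real.mul_abs_le_abs_sin ?_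
    rw [abs_le]
    constructor <;> linarith [hp.1, hp.2]
  have h2 := pow_le_pow_left₀ (by positivity) h 2
  rw [mul_pow, sq_abs, sq_abs] at h2
  rw [qsym, Complex.norm_exp_I_mul_ofReal_sub_one, Real.norm_eq_abs, sq_abs, mul_pow]
  calc 4 / Real.pi ^ 2 * p i ^ 2 = 4 * ((2 / Real.pi) ^ 2 * (p i / 2) ^ 2) := by ring
    _ ≤ 2 ^ 2 * Real.sin (p i / 2) ^ 2 := by linarith

lemma qpow_single {d : ℕ} (p : Fin d → ℝ) (i : Fin d) :
    qpow p (Pi.single i 1) = qsym p i := by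
  rw [qpow, Finset.prod_eq_single i]
  · simp
  · intro j _ hj
    simp [Pi.single_eq_of_ne hj]
  · simp

lemma norm_qpow_sq_le {d : ℕ} (p : Fin d → ℝ)
    (hp : ∀ i, p i ∈ Set.Icc (-Real.pi) Real.pi) {α : Fin d → ℕ} (hα : α ≠ 0) {R : ℕ}
    (hR : ∀ i, α i ≤ R) :
    ‖qpow p α‖ ^ 2 ≤ (d * Real.pi ^ 2) ^ (d * R) * ∑ i, p i ^ 2 := by
  obtain ⟨i, hi⟩ := Function.ne_iff.mp hα
  replace hi : 1 ≤ α i := Nat.one_le_iff_ne_zero.mpr hi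
  have hd : (1 : ℝ) ≤ d := by exact_mod_cast i.pos
  have hpi : 1 ≤ Real.pi ^ 2 := by nlinarith [Real.pi_gt_three]
  set K : ℝ := d * Real.pi ^ 2 with hK
  have hK1 : 1 ≤ K := by nlinarith
  have hpK : ∀ j, ‖qsym p j‖ ^ 2 ≤ K := fun j => by
    have h1 : p j ^ 2 ≤ Real.pi ^ 2 := by
      rw [sq_le_sq, abs_of_pos Real.pi_pos, abs_le]
      exact hp j
    nlinarith [norm_qsym_sq_le p j]
  have hpow : ∀ j n, n ≤ R → (‖qsym p j‖ ^ 2) ^ n ≤ K ^ R := fun j n hn =>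
    (pow_le_pow_left₀ (sq_nonneg _) (hpK j) n).trans (pow_le_pow_right₀ hK1 hn)
  have hprod : ‖qpow p α‖ ^ 2 = ∏ j, (‖qsym p j‖ ^ 2) ^ α j := by
    rw [qpow, norm_prod, ← Finset.prod_pow]
    refine Finset.prod_congr rfl fun j _ => ?_
    rw [norm_pow, ← pow_mul, ← pow_mul, mul_comm]
  have hfactor : (‖qsym p i‖ ^ 2) ^ α i ≤ (∑ j, p j ^ 2) * K ^ R := by
    obtain ⟨n, hn⟩ := Nat.exists_eq_add_of_le' hi
    rw [hn, pow_succ']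
    refine mul_le_mul ?_ (hpow i n (by have := hR i; omega)) (by positivity)
      (Finset.sum_nonneg fun j _ => sq_nonneg _)
    exact (norm_qsym_sq_le p i).trans
      (Finset.single_le_sum (f := fun j => p j ^ 2) (fun j _ => sq_nonneg _)
        (Finset.mem_univ i))
  rw [hprod, ← Finset.mul_prod_erase _ _ (Finset.mem_univ i)]
  have hrest : ∏ j ∈ Finset.univ.erase i, (‖qsym p j‖ ^ 2) ^ α j ≤
      ∏ _j ∈ Finset.univ.erase i, K ^ R :=
    Finset.prod_le_prod (fun j _ => by positivity) fun j _ => hpow j _ (hR j)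
  calc _ ≤ ((∑ j, p j ^ 2) * K ^ R) * ∏ _j ∈ Finset.univ.erase i, K ^ R :=
        mul_le_mul hfactor hrest (Finset.prod_nonneg fun j _ => by positivity)
          (mul_nonneg (Finset.sum_nonneg fun j _ => sq_nonneg _) (by positivity))
    _ = (∑ j, p j ^ 2) * ∏ _j : Fin d, K ^ R := by
        rw [← Finset.mul_prod_erase Finset.univ (fun _ => K ^ R) (Finset.mem_univ i), mul_assoc]
    _ = _ := by
        rw [Finset.prod_const, Finset.card_univ, Fintype.card_fin, ← pow_mul, mul_comm,
          mul_comm R d]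

section L2OpNorm

open scoped Matrix.Norms.L2Operator

/-- The `ℓ²` operator norm does not grow under complexification of a real matrix. -/
lemma l2_opNorm_map_ofReal_le {n : Type*} [Fintype n] [DecidableEq n] (M : Matrix n n ℝ) :
    ‖M.map ((↑) : ℝ → ℂ)‖ ≤ ‖M‖ := by
  rw [Matrix.l2_opNorm_def (M.map _)]
  refine ContinuousLinearMap.opNorm_le_bound _ (norm_nonneg _) fun z => ?_
  refine (pow_le_pow_iff_left₀ (norm_nonneg _) (by positivity) two_ne_zero).mp ?_
  have key : ∀ x : n → ℝ, ∑ i, (M *ᵥ x) i ^ 2 ≤ ‖M‖ ^ 2 * ∑ i, x i ^ 2 := fun x => by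
    have h := pow_le_pow_left₀ (norm_nonneg _) (M.l2_opNorm_mulVec (WithLp.toLp 2 x)) 2
    rw [mul_pow, EuclideanSpace.norm_sq_eq, EuclideanSpace.norm_sq_eq] at h
    simpa [sq_abs] using h
  rw [mul_pow, EuclideanSpace.norm_sq_eq, EuclideanSpace.norm_sq_eq]
  have hz : ∀ i, ‖z i‖ ^ 2 = (z i).re ^ 2 + (z i).im ^ 2 := fun i => by
    rw [Complex.sq_norm, Complex.normSq_apply]; ring
  have hMz : ∀ i, ‖(M.map ((↑) : ℝ → ℂ) *ᵥ z.ofLp) i‖ ^ 2 =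
      (M *ᵥ fun j => (z j).re) i ^ 2 + (M *ᵥ fun j => (z j).im) i ^ 2 := fun i => by
    rw [Complex.sq_norm, Complex.normSq_apply]
    simp [Matrix.mulVec, dotProduct, sq]
  calc _ = ∑ i, ‖(M.map ((↑) : ℝ → ℂ) *ᵥ z.ofLp) i‖ ^ 2 := rfl
    _ ≤ _ := by
      simp only [hz, hMz, Finset.sum_add_distrib, mul_add]
      exact add_le_add (key _) (key _)

/-- The matrix of `a ↦ (q(p)^α a)_{α ∈ 𝓜}`. -/
noncomputable def qmat {d : ℕ} (m : ℕ) (𝓜 : Finset (Fin d → ℕ)) (p : Fin d → ℝ) :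
    Matrix ({α // α ∈ 𝓜} × Fin m) (Fin m) ℂ :=
  Matrix.of fun a s => if a.2 = s then qpow p a.1.1 else 0

lemma Ahat_eq_conjTranspose_mul_mul {d m : ℕ} (𝓜 : Finset (Fin d → ℕ))
    (A : ({α // α ∈ 𝓜} × Fin m) → ({α // α ∈ 𝓜} × Fin m) → ℝ) (p : Fin d → ℝ) :
    Ahat 𝓜 A p = (qmat m 𝓜 p)ᴴ * ((Matrix.of A).map ((↑) : ℝ → ℂ)) * qmat m 𝓜 p := by
  ext r s
  simp only [Ahat, Matrix.sum_apply, Matrix.smul_apply, Matrix.of_apply, smul_eq_mul,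
    Matrix.mul_apply, Matrix.conjTranspose_apply, qmat, Matrix.map_apply,
    Fintype.sum_prod_type, apply_ite star, star_zero, ite_mul, zero_mul, mul_ite, mul_zero,
    Finset.sum_ite_eq', Finset.mem_univ, if_true, Finset.sum_mul]
  rw [Finset.sum_comm]
  refine Finset.sum_congr rfl fun α _ => Finset.sum_congr rfl fun β _ => ?_
  rw [starRingEnd_apply]
  ring

lemma qmat_conjTranspose_mul_self {d : ℕ} (m : ℕ) (𝓜 : Finset (Fin d → ℕ)) (p : Fin d → ℝ) :
    (qmat m 𝓜 p)ᴴ * qmat m 𝓜 p =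
      ((∑ α ∈ 𝓜, ‖qpow p α‖ ^ 2 : ℝ) : ℂ) • (1 : Matrix (Fin m) (Fin m) ℂ) := by
  ext r s
  simp only [Matrix.mul_apply, Matrix.conjTranspose_apply, qmat, Matrix.of_apply,
    Fintype.sum_prod_type, apply_ite star, star_zero, ite_mul, zero_mul, mul_ite, mul_zero,
    Finset.sum_ite_eq', Finset.mem_univ, if_true, Matrix.smul_apply, smul_eq_mul,
    Matrix.one_apply]
  rw [← Finset.sum_coe_sort 𝓜]
  by_cases h : r = s
  · subst h
    simp [← Complex.conj_mul']
  · simp [h, Ne.symm h]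

lemma norm_qmat_mul_self_le {d : ℕ} (m : ℕ) (𝓜 : Finset (Fin d → ℕ)) (p : Fin d → ℝ) :
    ‖qmat m 𝓜 p‖ * ‖qmat m 𝓜 p‖ ≤ ∑ α ∈ 𝓜, ‖qpow p α‖ ^ 2 := by
  have hS : 0 ≤ ∑ α ∈ 𝓜, ‖qpow p α‖ ^ 2 := Finset.sum_nonneg fun _ _ => sq_nonneg _
  rw [← Matrix.l2_opNorm_conjTranspose_mul_self, qmat_conjTranspose_mul_self, norm_smul,
    Complex.norm_real, Real.norm_of_nonneg hS]
  refine mul_le_of_le_one_right hS ?_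
  rw [Matrix.cstar_norm_def, map_one]
  exact ContinuousLinearMap.norm_id_le

lemma norm_Ahat_le {d m : ℕ} (𝓜 : Finset (Fin d → ℕ))
    (A : ({α // α ∈ 𝓜} × Fin m) → ({α // α ∈ 𝓜} × Fin m) → ℝ) (p : Fin d → ℝ) :
    ‖Matrix.toEuclideanCLM (𝕜 := ℂ) (Ahat 𝓜 A p)‖ ≤
      ‖Matrix.toEuclideanCLM (𝕜 := ℝ) (Matrix.of A)‖ * ∑ α ∈ 𝓜, ‖qpow p α‖ ^ 2 := by
  rw [← Matrix.cstar_norm_def, ← Matrix.cstar_norm_def, Ahat_eq_conjTranspose_mul_mul]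
  set B := qmat m 𝓜 p
  calc _ ≤ ‖Bᴴ‖ * ‖(Matrix.of A).map ((↑) : ℝ → ℂ)‖ * ‖B‖ :=
        (Matrix.l2_opNorm_mul _ _).trans
          (mul_le_mul_of_nonneg_right (Matrix.l2_opNorm_mul _ _) (norm_nonneg _))
    _ = ‖(Matrix.of A).map ((↑) : ℝ → ℂ)‖ * (‖B‖ * ‖B‖) := by
        rw [Matrix.l2_opNorm_conjTranspose]; ring
    _ ≤ _ := mul_le_mul (l2_opNorm_map_ofReal_le _) (norm_qmat_mul_self_le m 𝓜 p)
        (by positivity) (norm_nonneg _)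

end L2OpNorm

lemma re_dotProduct_Ahat_mulVec {d m : ℕ} (𝓜 : Finset (Fin d → ℕ))
    (A : ({α // α ∈ 𝓜} × Fin m) → ({α // α ∈ 𝓜} × Fin m) → ℝ) (p : Fin d → ℝ)
    (a : Fin m → ℝ) :
    ((star fun r => (a r : ℂ)) ⬝ᵥ Ahat 𝓜 A p *ᵥ fun r => (a r : ℂ)).re =
      (∑ x, ∑ y, ((qpow p x.1.1).re * a x.2) * A x y * ((qpow p y.1.1).re * a y.2)) +
      ∑ x, ∑ y, ((qpow p x.1.1).im * a x.2) * A x y * ((qpow p y.1.1).im * a y.2) := by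
  have hB : (qmat m 𝓜 p) *ᵥ (fun r => (a r : ℂ)) = fun x => qpow p x.1.1 * a x.2 := by
    ext x
    simp [Matrix.mulVec, dotProduct, qmat]
  rw [Ahat_eq_conjTranspose_mul_mul, ← Matrix.mulVec_mulVec, ← Matrix.mulVec_mulVec,
    Matrix.dotProduct_mulVec, ← Matrix.star_mulVec, hB]
  simp only [dotProduct, Matrix.mulVec, Complex.re_sum, Finset.mul_sum,
    ← Finset.sum_add_distrib]
  refine Finset.sum_congr rfl fun x _ => Finset.sum_congr rfl fun y _ => ?_
  simp
  ring

/-- **Upper and lower bounds on the Fourier symbol of an elliptic difference operator:**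
`‖Â(p)‖ ≤ Ω₀|𝓜|(dπ²)^{dR}|p|²` and `a·Â(p)a ≥ (4ω₀/π²)|p|²|a|²`. -/
theorem stmt0 (d m : ℕ) (hd : 1 ≤ d) (hm : 1 ≤ m)
    (𝓜 : Finset (Fin d → ℕ)) (h𝓜0 : (0 : Fin d → ℕ) ∉ 𝓜)
    (h𝓜1 : ∀ i : Fin d, Pi.single i 1 ∈ 𝓜)
    (R : ℕ) (hR : R = 𝓜.sup fun α => Finset.univ.sup α)
    (ω₀ Ω₀ : ℝ) (hω₀ : 0 < ω₀)
    (A : ({α // α ∈ 𝓜} × Fin m) → ({α // α ∈ 𝓜} × Fin m) → ℝ)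
    (hAsymm : ∀ a b, A a b = A b a)
    (hAnorm : ‖Matrix.toEuclideanCLM (𝕜 := ℝ) (Matrix.of A)‖ ≤ Ω₀)
    (hAlow : ∀ z : ({α // α ∈ 𝓜} × Fin m) → ℝ,
      ω₀ * ∑ i : Fin d, ∑ r : Fin m, z (⟨Pi.single i 1, h𝓜1 i⟩, r) ^ 2 ≤
        ∑ a, ∑ b, z a * A a b * z b)
    (p : Fin d → ℝ) (hp : ∀ i, p i ∈ Set.Icc (-Real.pi) Real.pi) :
    ‖Matrix.toEuclideanCLM (𝕜 := ℂ) (Ahat 𝓜 A p)‖ ≤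
        Ω₀ * 𝓜.card * (d * Real.pi ^ 2) ^ (d * R) * ∑ i, p i ^ 2 ∧
      ∀ a : Fin m → ℝ,
        4 * ω₀ / Real.pi ^ 2 * (∑ i, p i ^ 2) * (∑ r, a r ^ 2) ≤
          ((star fun r => (a r : ℂ)) ⬝ᵥ Ahat 𝓜 A p *ᵥ fun r => (a r : ℂ)).re := by
  constructor
  · have hΩ : 0 ≤ Ω₀ := (norm_nonneg _).trans hAnorm
    have hq : ∑ α ∈ 𝓜, ‖qpow p α‖ ^ 2 ≤
        𝓜.card • ((d * Real.pi ^ 2) ^ (d * R) * ∑ i, p i ^ 2) := by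
      refine Finset.sum_le_card_nsmul _ _ _ fun α hα => ?_
      refine norm_qpow_sq_le p hp (ne_of_mem_of_not_mem hα h𝓜0) fun i => ?_
      rw [hR]
      exact (Finset.le_sup (f := α) (Finset.mem_univ i)).trans
        (Finset.le_sup (f := fun α : Fin d → ℕ => Finset.univ.sup α) hα)
    calc _ ≤ _ := norm_Ahat_le 𝓜 A p
      _ ≤ Ω₀ * (𝓜.card • ((d * Real.pi ^ 2) ^ (d * R) * ∑ i, p i ^ 2)) :=
        mul_le_mul hAnorm hq (Finset.sum_nonneg fun _ _ => sq_nonneg _) hΩ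
      _ = _ := by rw [nsmul_eq_mul]; ring
  · intro a
    rw [re_dotProduct_Ahat_mulVec]
    refine le_trans ?_ (add_le_add (hAlow fun x => (qpow p x.1.1).re * a x.2)
      (hAlow fun x => (qpow p x.1.1).im * a x.2))
    simp only [qpow_single]
    rw [← mul_add, ← Finset.sum_add_distrib]
    calc _ = ω₀ * ∑ i, (4 / Real.pi ^ 2 * p i ^ 2) * ∑ r, a r ^ 2 := by
          rw [← Finset.sum_mul, ← Finset.mul_sum]; ring
      _ ≤ _ := by
          refine mul_le_mul_of_nonneg_left (Finset.sum_le_sum fun i _ => ?_) hω₀.le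
          refine (mul_le_mul_of_nonneg_right (le_norm_qsym_sq p i (hp i))
            (Finset.sum_nonneg fun _ _ => sq_nonneg _)).trans_eq ?_
          rw [Complex.sq_norm, Complex.normSq_apply, Finset.mul_sum, ← Finset.sum_add_distrib]
          exact Finset.sum_congr rfl fun r _ => by ring
end

section
/- Fix an odd integer L ≥ 3, integers d ≥ 2, m ≥ 1, N ≥ 1, and let T_N = (ℤ/L^Nℤ)^d with quotient maximum distance d_∞. Let 𝒳_N = {φ : T_N → ℝ^m : Σ_{x∈T_N} φ(x) = 0}, and let 𝒞 : 𝒳_N → 𝒳_N be a translation invariant linear operator with kernel C : T_N → ℝ^{m×m} of zero average, so that (𝒞φ)(x) = Σ_{y∈T_N} C(x−y)φ(y). Let l ≥ 0 with 2l + 3 < L^N. Then the following three statements are equivalent: (1) ⟨φ, 𝒞ψ⟩ = 0 for all φ, ψ ∈ 𝒳_N with dist_∞(supp φ, supp ψ) > l; (2) there is a matrix M ∈ ℝ^{m×m} such that C(x) = M whenever d_∞(x, 0) > l; (3) supp(𝒞φ) ⊂ supp φ + {−l,…,l}^d for all φ ∈ 𝒳_N. Moreover, the implications (2) ⇒ (3)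 ⇒ (1) hold without the restriction 2l + 3 < L^N. -/
open Matrix
open scoped Matrix BigOperators

/-- Quotient maximum distance on the discrete torus `(ℤ/nℤ)^d`. -/
def torusDist {n d : ℕ} [NeZero n] (x y : Fin d → ZMod n) : ℕ :=
  Finset.univ.sup fun i => min (x i - y i).val (n - (x i - y i).val)

/-- The translation invariant operator with kernel `C`, `(𝒞φ)(x) = Σ_y C(x−y)φ(y)`. -/
def kerOp {n d m : ℕ} [NeZero n] (C : (Fin d → ZMod n) → Matrix (Fin m) (Fin m) ℝ)
    (φ : (Fin d → ZMod n) → Fin m → ℝ) : (Fin d → ZMod n) → Fin m → ℝ :=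
  fun x => ∑ y, C (x - y) *ᵥ φ y

lemma eq_or_eq_of_single_sub_single_ne_zero {n d m : ℕ} {a b x : Fin d → ZMod n} {u : Fin m → ℝ}
    (h : (Pi.single a u - Pi.single b u : (Fin d → ZMod n) → Fin m → ℝ) x ≠ 0) :
    x = a ∨ x = b := by
  contrapose! h
  simp [Pi.single_eq_of_ne h.1, Pi.single_eq_of_ne h.2]

section FiniteRange

variable {n d m : ℕ} [NeZero n]

lemma torusDist_sub_zero (x y : Fin d → ZMod n) : torusDist (x - y) 0 = torusDist x y := by
  simp [torusDist]

lemma lt_torusDist_zero {l : ℕ} {x : Fin d → ZMod n} :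
    l < torusDist x 0 ↔ ∃ i, l < min (x i).val (n - (x i).val) := by
  simp [torusDist, Finset.lt_sup_iff]

lemma kerOp_single_sub_single (C : (Fin d → ZMod n) → Matrix (Fin m) (Fin m) ℝ)
    (a b : Fin d → ZMod n) (v : Fin m → ℝ) (x : Fin d → ZMod n) :
    kerOp C (Pi.single a v - Pi.single b v) x = C (x - a) *ᵥ v - C (x - b) *ᵥ v := by
  have key : ∀ c : Fin d → ZMod n,
      ∑ y, C (x - y) *ᵥ (Pi.single c v : (Fin d → ZMod n) → Fin m → ℝ) y = C (x - c) *ᵥ v := by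
    intro c
    rw [Finset.sum_eq_single c]
    · simp
    · intro y _ hy
      simp [Pi.single_eq_of_ne hy]
    · simp
  simp only [kerOp, Pi.sub_apply, mulVec_sub, Finset.sum_sub_distrib, key]

lemma sum_single_sub_single_dotProduct (F : (Fin d → ZMod n) → Fin m → ℝ)
    (a b : Fin d → ZMod n) (u : Fin m → ℝ) :
    ∑ x, (Pi.single a u - Pi.single b u : (Fin d → ZMod n) → Fin m → ℝ) x ⬝ᵥ F x =
      u ⬝ᵥ F a - u ⬝ᵥ F b := by
  have key : ∀ c : Fin d → ZMod n,
      ∑ y, (Pi.single c u : (Fin d → ZMod n) → Fin m → ℝ) y ⬝ᵥ F y = u ⬝ᵥ F c := by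
    intro c
    rw [Finset.sum_eq_single c]
    · simp
    · intro y _ hy
      simp [Pi.single_eq_of_ne hy]
    · simp
  simp only [Pi.sub_apply, sub_dotProduct, Finset.sum_sub_distrib, key]

lemma sum_single_sub_single (a b : Fin d → ZMod n) (u : Fin m → ℝ) :
    ∑ x, (Pi.single a u - Pi.single b u : (Fin d → ZMod n) → Fin m → ℝ) x = 0 := by
  simp [Finset.sum_sub_distrib]

variable {C : (Fin d → ZMod n) → Matrix (Fin m) (Fin m) ℝ} {l : ℕ}

/-- If `𝒞` does not couple fields at distance `> l`, the increment `C(x) − C(x − b)` does not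
depend on `x` as long as `x` and `x − b` lie outside the ball of radius `l`. -/
lemma kernel_increment_eq
    (h : ∀ φ ψ : (Fin d → ZMod n) → Fin m → ℝ, (∑ x, φ x = 0) → (∑ x, ψ x = 0) →
      (∀ x y, φ x ≠ 0 → ψ y ≠ 0 → l < torusDist x y) → ∑ x, φ x ⬝ᵥ kerOp C ψ x = 0)
    {b x y : Fin d → ZMod n}
    (hx : l < torusDist x 0) (hxb : l < torusDist (x - b) 0)
    (hy : l < torusDist y 0) (hyb : l < torusDist (y - b) 0) :
    C x - C (x - b) = C y - C (y - b) := by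
  rw [torusDist_sub_zero] at hxb hyb
  ext p q
  set u : Fin m → ℝ := Pi.single p 1 with hu
  set v : Fin m → ℝ := Pi.single q 1 with hv
  have hsep : ∀ x' y', (Pi.single x u - Pi.single y u : (Fin d → ZMod n) → Fin m → ℝ) x' ≠ 0 →
      (Pi.single 0 v - Pi.single b v : (Fin d → ZMod n) → Fin m → ℝ) y' ≠ 0 →
      l < torusDist x' y' := by
    intro x' y' hx' hy'
    obtain hx' | hx' := eq_or_eq_of_single_sub_single_ne_zero hx'
    · obtain hy' | hy' := eq_or_eq_of_single_sub_single_ne_zero hy'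
      · exact hx' ▸ hy' ▸ hx
      · exact hx' ▸ hy' ▸ hxb
    · obtain hy' | hy' := eq_or_eq_of_single_sub_single_ne_zero hy'
      · exact hx' ▸ hy' ▸ hy
      · exact hx' ▸ hy' ▸ hyb
  have horth := h _ _ (sum_single_sub_single x y u) (sum_single_sub_single 0 b v) hsep
  rw [sum_single_sub_single_dotProduct, kerOp_single_sub_single, kerOp_single_sub_single,
    sub_eq_zero, hu, hv] at horth
  simpa only [sub_zero, single_one_dotProduct, mulVec_single_one, Pi.sub_apply, col_apply,
    Matrix.sub_apply] using horth

/-- Under the same hypothesis, the kernel takes the same value at any two points outside the ball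
of radius `l` that share a coordinate, as soon as this ball does not fill the torus. -/
lemma kernel_eq_of_coord_eq
    (h : ∀ φ ψ : (Fin d → ZMod n) → Fin m → ℝ, (∑ x, φ x = 0) → (∑ x, ψ x = 0) →
      (∀ x y, φ x ≠ 0 → ψ y ≠ 0 → l < torusDist x y) → ∑ x, φ x ⬝ᵥ kerOp C ψ x = 0)
    {c : ZMod n} (hc : l < min c.val (n - c.val)) {x y : Fin d → ZMod n} {i : Fin d}
    (hxy : x i = y i) (hx : l < torusDist x 0) (hy : l < torusDist y 0) : C x = C y := by
  set b : Fin d → ZMod n := x - y with hb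
  have hbi : b i = 0 := by simp [hb, hxy]
  have hxb : x - b = y := by simp [hb]
  let z : ZMod n → Fin d → ZMod n := fun s j => c + s * b j
  have hz : ∀ s, l < torusDist (z s) 0 := fun s =>
    lt_torusDist_zero.2 ⟨i, by simpa [z, hbi] using hc⟩
  have hzb : ∀ s, z s - b = z (s - 1) := by
    intro s
    ext j
    simp only [z, Pi.sub_apply]
    ring
  have hinc : ∀ s, C x - C y = C (z s) - C (z (s - 1)) := by
    intro s
    rw [← hxb, ← hzb]
    exact kernel_increment_eq h hx (hxb ▸ hy) (hz s) (hzb s ▸ hz _)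
  have hshift : ∑ s, C (z (s - 1)) = ∑ s, C (z s) :=
    Equiv.sum_comp (Equiv.subRight (1 : ZMod n)) fun s => C (z s)
  have hsum : ∑ _s : ZMod n, (C x - C y) = 0 := by
    rw [Finset.sum_congr rfl fun s _ => hinc s, Finset.sum_sub_distrib, hshift, sub_self]
  rw [Finset.sum_const, Finset.card_univ, ZMod.card, ← Nat.cast_smul_eq_nsmul ℝ] at hsum
  exact sub_eq_zero.1 ((smul_eq_zero.1 hsum).resolve_left (NeZero.ne (n : ℝ)))

lemma kernel_eq_const_of_orthogonal (hd : 2 ≤ d) (hl : 2 * l + 1 < n)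
    (h : ∀ φ ψ : (Fin d → ZMod n) → Fin m → ℝ, (∑ x, φ x = 0) → (∑ x, ψ x = 0) →
      (∀ x y, φ x ≠ 0 → ψ y ≠ 0 → l < torusDist x y) → ∑ x, φ x ⬝ᵥ kerOp C ψ x = 0) :
    ∃ M : Matrix (Fin m) (Fin m) ℝ, ∀ x : Fin d → ZMod n, l < torusDist x 0 → C x = M := by
  have : Nontrivial (Fin d) := Fin.nontrivial_iff_two_le.2 hd
  let c : ZMod n := ((l + 1 : ℕ) : ZMod n)
  have hc : l < min c.val (n - c.val) := by
    rw [ZMod.val_natCast_of_lt (by omega)]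
    omega
  refine ⟨C fun _ => c, fun x hx => ?_⟩
  obtain ⟨i, hi⟩ := lt_torusDist_zero.1 hx
  obtain ⟨k, hk⟩ := exists_ne i
  let y : Fin d → ZMod n := Function.update (fun _ => c) i (x i)
  have hy : l < torusDist y 0 := lt_torusDist_zero.2 ⟨i, by simpa [y] using hi⟩
  calc C x = C y := kernel_eq_of_coord_eq h hc (i := i) (by simp [y]) hx hy
    _ = C fun _ => c := kernel_eq_of_coord_eq h hc (i := k) (by simp [y, hk]) hy
        (lt_torusDist_zero.2 ⟨i, hc⟩)

lemma exists_torusDist_le_of_kerOp_ne_zero {M : Matrix (Fin m) (Fin m) ℝ}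
    (hM : ∀ x : Fin d → ZMod n, l < torusDist x 0 → C x = M)
    {φ : (Fin d → ZMod n) → Fin m → ℝ} (hφ : ∑ x, φ x = 0) {x : Fin d → ZMod n}
    (hx : kerOp C φ x ≠ 0) : ∃ y, φ y ≠ 0 ∧ torusDist x y ≤ l := by
  contrapose! hx
  calc kerOp C φ x = ∑ y, M *ᵥ φ y := by
        refine Finset.sum_congr rfl fun y _ => ?_
        by_cases hy : φ y = 0
        · simp [hy]
        · rw [hM _ (by rw [torusDist_sub_zero]; exact hx y hy)]
    _ = M *ᵥ ∑ y, φ y := (map_sum (mulVecLin M) φ Finset.univ).symm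
    _ = 0 := by rw [hφ, mulVec_zero]

end FiniteRange

/-- **Characterisations of finite range** (Lemma 2.1 of the paper). For a translation
invariant operator `𝒞` with zero-average kernel `C` on the torus `(ℤ/L^Nℤ)^d`, the three
properties (1) `⟨φ, 𝒞ψ⟩ = 0` whenever the supports of `φ, ψ` have `d_∞`-distance `> l`,
(2) `C ≡ M` outside the ball of radius `l`, and (3) `supp 𝒞φ ⊂ supp φ + {−l,…,l}^d`
are equivalent when `2l + 3 < L^N`, and `(2) ⇒ (3) ⇒ (1)` always. -/
theorem stmt1 (L N d m l : ℕ) [NeZero (L ^ N)]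
    (hL : Odd L) (hL3 : 3 ≤ L) (hd : 2 ≤ d) (hm : 1 ≤ m) (hN : 1 ≤ N)
    (C : (Fin d → ZMod (L ^ N)) → Matrix (Fin m) (Fin m) ℝ)
    (havg : ∀ i j, ∑ x, C x i j = 0) :
    letI P1 : Prop := ∀ φ ψ : (Fin d → ZMod (L ^ N)) → Fin m → ℝ,
      (∑ x, φ x = 0) → (∑ x, ψ x = 0) →
      (∀ x y, φ x ≠ 0 → ψ y ≠ 0 → l < torusDist x y) →
      ∑ x, φ x ⬝ᵥ kerOp C ψ x = 0
    letI P2 : Prop := ∃ M : Matrix (Fin m) (Fin m) ℝ,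
      ∀ x : Fin d → ZMod (L ^ N), l < torusDist x 0 → C x = M
    letI P3 : Prop := ∀ φ : (Fin d → ZMod (L ^ N)) → Fin m → ℝ, (∑ x, φ x = 0) →
      ∀ x, kerOp C φ x ≠ 0 → ∃ y, φ y ≠ 0 ∧ torusDist x y ≤ l
    (P2 → P3) ∧ (P3 → P1) ∧ (2 * l + 3 < L ^ N → (P1 → P2)) := by
  refine ⟨fun ⟨M, hM⟩ φ hφ x hx => exists_torusDist_le_of_kerOp_ne_zero hM hφ hx, ?_, ?_⟩
  · intro h φ ψ _ hψ hsep
    refine Finset.sum_eq_zero fun x _ => ?_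
    by_cases hx : φ x = 0
    · simp [hx]
    by_cases hk : kerOp C ψ x = 0
    · simp [hk]
    obtain ⟨y, hy, hle⟩ := h ψ hψ x hk
    exact absurd (hsep x y hx hy) (not_lt.2 hle)
  · exact fun hl h => kernel_eq_const_of_orthogonal hd (by omega) h
end

section
/- Let B > 0. There exists a family of functions W_t ∈ C^∞(ℝ) for t > 0, each W_t a polynomial of degree at most t, such that: (i) λ^{−1} = ∫₀^∞ t W_t(λ) dt for all λ ∈ (0, B); (ii) W_t(λ) ≥ 0 for all λ ∈ (0, B) and t > 0; (iii) for all integers ℓ, n ≥ 0 there is a constant C_{ℓ,n} such that (1 + t²λ)^n λ^ℓ |∂^ℓ_λ W_t(λ)| ≤ C_{ℓ,n} for all λ ∈ (0, B) and t > 0; and (iv) there is ε > 0 such that W_t(λ) ≥ ε whenever 0 < λ ≤ B·min(1, t^{−2}). -/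
open MeasureTheory FourierTransform Complex SchwartzMap
open scoped ContDiff Convolution Real

/-- The Fourier transform of an even, real-valued function is its cosine transform. -/
lemma fourier_ofReal_of_even {b : ℝ → ℝ} (hb : Integrable b) (heven : ∀ y, b (-y) = b y) (ξ : ℝ) :
    𝓕 (fun y => (b y : ℂ)) ξ = ((∫ y, Real.cos (2 * π * y * ξ) * b y : ℝ) : ℂ) := by
  have hexp : Integrable fun y : ℝ => exp (↑(-2 * π * y * ξ) * I) * (b y : ℂ) := by
    refine hb.ofReal.bdd_mul (c := 1) (by fun_prop) (Filter.Eventually.of_forall fun y => ?_)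
    rw [norm_exp_ofReal_mul_I]
  have hexp' : Integrable fun y : ℝ => exp (↑(2 * π * y * ξ) * I) * (b y : ℂ) := by
    refine hb.ofReal.bdd_mul (c := 1) (by fun_prop) (Filter.Eventually.of_forall fun y => ?_)
    rw [norm_exp_ofReal_mul_I]
  have hneg : ∫ y : ℝ, exp (↑(-2 * π * y * ξ) * I) * (b y : ℂ)
      = ∫ y : ℝ, exp (↑(2 * π * y * ξ) * I) * (b y : ℂ) := by
    rw [← integral_neg_eq_self]
    simp only [heven]
    congr! 5
    push_cast
    ring
  have hsum : ∫ y : ℝ, exp (↑(-2 * π * y * ξ) * I) * (b y : ℂ)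
      + exp (↑(2 * π * y * ξ) * I) * (b y : ℂ)
      = 2 * ((∫ y, Real.cos (2 * π * y * ξ) * b y : ℝ) : ℂ) := by
    rw [← integral_complex_ofReal, ← integral_const_mul]
    congr 1 with y
    push_cast
    rw [Complex.cos]
    ring_nf
  rw [integral_add hexp hexp', ← hneg] at hsum
  rw [Real.fourier_real_eq_integral_exp_smul]
  simp only [smul_eq_mul]
  linear_combination hsum / 2

/-- There is a smooth function supported in `[-1, 1]` whose Fourier transform is real, even,
non-negative everywhere and positive on `[-1/4, 1/4]`. -/
lemma exists_contDiff_fourier_nonneg :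
    ∃ g φ : ℝ → ℝ, ContDiff ℝ ∞ g ∧ (∀ y, 1 < |y| → g y = 0) ∧
      (∀ ξ, 𝓕 (fun y => (g y : ℂ)) ξ = φ ξ) ∧ (∀ ξ, 0 ≤ φ ξ) ∧ (∀ ξ, φ (-ξ) = φ ξ) ∧
      ∀ ξ, |ξ| ≤ 1 / 4 → 0 < φ ξ := by
  let b : ContDiffBump (0 : ℝ) := ⟨1 / 4, 1 / 2, by norm_num, by norm_num⟩
  have hbs : ∀ y, b y ≠ 0 → |y| < 1 / 2 := fun y hy => by
    have : y ∈ Function.support b := hy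
    rw [b.support_eq] at this
    simpa [b] using this
  have hbi : Integrable b := b.integrable
  let g : ℝ → ℝ := (b : ℝ → ℝ) ⋆[ContinuousLinearMap.mul ℝ ℝ, volume] b
  let κ : ℝ → ℝ := fun ξ => ∫ y, Real.cos (2 * π * y * ξ) * b y
  refine ⟨g, fun ξ => κ ξ * κ ξ, ?_, ?_, ?_, fun ξ => mul_self_nonneg _, ?_, ?_⟩
  · exact b.hasCompactSupport.contDiff_convolution_left _ b.contDiff hbi.locallyIntegrable
  · intro y hy
    by_contra h
    obtain ⟨u, hu, v, hv, rfl⟩ := Set.mem_add.1 (support_convolution_subset _ h)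
    have := abs_add_le u v
    linarith [hbs u hu, hbs v hv]
  · intro ξ
    have hconv : (fun y => (g y : ℂ)) = (fun y => (b y : ℂ))
        ⋆[ContinuousLinearMap.mul ℂ ℂ, volume] (fun y => (b y : ℂ)) := by
      ext y
      simp only [g, convolution_def, ContinuousLinearMap.mul_apply', ← integral_complex_ofReal]
      push_cast
      rfl
    have hmul := Real.fourier_mul_convolution_eq (f₁ := fun y => (b y : ℂ))
      (f₂ := fun y => (b y : ℂ)) hbi.ofReal hbi.ofReal ξ
    rw [hconv, hmul, fourier_ofReal_of_even hbi b.neg]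
    push_cast
    rfl
  · intro ξ
    simp only [κ, mul_neg, Real.cos_neg]
  · intro ξ hξ
    refine mul_self_pos.2 (ne_of_gt ?_)
    refine Continuous.integral_pos_of_hasCompactSupport_nonneg_nonzero (x := 0) ?_
      b.hasCompactSupport.mul_left (fun y => ?_) ?_
    · exact (by fun_prop : Continuous fun y => Real.cos (2 * π * y * ξ)).mul b.continuous
    · by_cases hy : b y = 0
      · simp [hy]
      · refine mul_nonneg (Real.cos_nonneg_of_mem_Icc (abs_le.1 ?_)) b.nonneg
        rw [abs_mul, abs_mul, abs_of_pos Real.two_pi_pos]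
        have := mul_le_mul (hbs y hy).le hξ (abs_nonneg _) (by norm_num)
        nlinarith [Real.pi_pos]
    · have : b 0 = 1 := b.one_of_mem_closedBall (by simp [b])
      simp [this]

/-- The partial fraction expansion of `π² / sin²(π a)`. -/
lemma hasSum_inv_sub_intCast_sq {a : ℝ} (ha : Real.sin (π * a) ≠ 0) :
    HasSum (fun n : ℤ => ((a - n) ^ 2)⁻¹) (π ^ 2 / Real.sin (π * a) ^ 2) := by
  have hL2 : MemLp (fun x : ℝ => exp (2 * π * I * a * x)) 2
      (volume.restrict (Set.Ioc (0 : ℝ) 1)) := by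
    refine MemLp.of_bound (by fun_prop) 1 (Filter.Eventually.of_forall fun x => ?_)
    rw [show 2 * π * I * a * x = ((2 * π * a * x : ℝ) : ℂ) * I by push_cast; ring,
      norm_exp_ofReal_mul_I]
  have h := hasSum_sq_fourierCoeffOn zero_lt_one hL2
  have hval : ∀ n : ℤ, ‖fourierCoeffOn zero_lt_one (fun x : ℝ => exp (2 * π * I * a * x)) n‖ ^ 2
      = Real.sin (π * a) ^ 2 / π ^ 2 * ((a - n) ^ 2)⁻¹ := by
    intro n
    have han : a - n ≠ 0 := by
      intro h0
      refine ha (Real.sin_eq_zero_iff.2 ⟨n, ?_⟩)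
      rw [show a = n by linarith]
      ring
    have hc : 2 * π * I * (a - n) ≠ 0 := by
      have : ((a - n : ℝ) : ℂ) ≠ 0 := ofReal_ne_zero.2 han
      push_cast at this
      simp [Real.pi_ne_zero, this]
    have hint : ∀ x : ℝ, fourier (-n) (x : AddCircle ((1 : ℝ) - 0)) • exp (2 * π * I * a * x)
        = exp (2 * π * I * (a - n) * x) := by
      intro x
      rw [fourier_coe_apply, smul_eq_mul, ← Complex.exp_add]
      push_cast
      ring_nf
    rw [fourierCoeffOn_eq_integral]
    simp only [hint]
    rw [integral_exp_mul_complex hc]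
    have hn : exp (2 * π * I * (a - n) * (1 : ℝ)) = exp (2 * (π * a * I)) := by
      rw [show 2 * π * I * (a - n) * (1 : ℝ) = 2 * (π * a * I) - n * (2 * π * I) by
        push_cast; ring, Complex.exp_periodic.sub_int_mul_eq]
    have hsin : exp (2 * (π * a * I)) - 1
        = 2 * I * ((Real.sin (π * a) : ℝ) : ℂ) * exp ((π * a : ℝ) * I) := by
      push_cast
      rw [Complex.sin]
      have h2 : exp (2 * (π * a * I)) = exp (π * a * I) * exp (π * a * I) := by
        rw [← Complex.exp_add]; ring_nf
      have h3 : exp (-(π * a) * I) * exp (π * a * I) = 1 := by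
        rw [← Complex.exp_add]; simp
      rw [h2]
      linear_combination h3 -
        (exp (-(π * a) * I) - exp (π * a * I)) * exp (π * a * I) * I_sq
    rw [hn, ofReal_zero, mul_zero, Complex.exp_zero, hsin]
    simp only [norm_smul, norm_div, norm_mul, norm_exp_ofReal_mul_I, norm_I, Complex.norm_real]
    rw [← ofReal_intCast, ← ofReal_sub, Complex.norm_real]
    simp only [Real.norm_eq_abs, Complex.norm_ofNat, abs_of_pos Real.pi_pos, sub_zero, div_one,
      abs_one]
    field_simp
    rw [sq_abs, sq_abs]
    ring
  simp only [hval] at h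
  have hn : ∀ x : ℝ, ‖exp (2 * π * I * a * x)‖ = 1 := fun x => by
    rw [show 2 * π * I * a * x = ((2 * π * a * x : ℝ) : ℂ) * I by push_cast; ring,
      norm_exp_ofReal_mul_I]
  simp only [hn] at h
  have h2 := h.mul_left (π ^ 2 / Real.sin (π * a) ^ 2)
  have hpi := Real.pi_ne_zero
  have h1 : ((1 : ℝ) - 0)⁻¹ • ∫ _ in (0 : ℝ)..1, (1 : ℝ) ^ 2 = 1 := by simp
  rw [h1, mul_one] at h2
  have heq : ∀ n : ℤ, π ^ 2 / Real.sin (π * a) ^ 2 *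
      (Real.sin (π * a) ^ 2 / π ^ 2 * ((a - n) ^ 2)⁻¹) = ((a - n) ^ 2)⁻¹ := fun n => by field_simp
  simpa only [heq] using h2

/-- The trigonometric polynomial `t⁻¹ ∑ g(k/t) e^{ikθ}` over the integers `|k| ≤ t`. -/
noncomputable def trigSum (g : ℝ → ℂ) (t θ : ℝ) : ℂ :=
  ∑ k ∈ Finset.Icc (-⌊t⌋) ⌊t⌋, (t : ℂ)⁻¹ * g (k / t) * exp (k * θ * I)

lemma hasDerivAt_trigSum (g : ℝ → ℂ) {t : ℝ} (ht : t ≠ 0) (θ : ℝ) :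
    HasDerivAt (trigSum g t) (t * trigSum (fun y => I * y * g y) t θ) θ := by
  unfold trigSum
  rw [Finset.mul_sum]
  refine HasDerivAt.fun_sum fun k _ => ?_
  have h : HasDerivAt (fun θ : ℝ => (k : ℂ) * θ * I) ((k : ℂ) * 1 * I) θ :=
    ((hasDerivAt_id θ).ofReal_comp.const_mul (k : ℂ)).mul_const I
  have ht' : (t : ℂ) ≠ 0 := ofReal_ne_zero.2 ht
  refine (h.cexp.const_mul ((t : ℂ)⁻¹ * g (k / t))).congr_deriv ?_
  push_cast
  field_simp

lemma hasCompactSupport_of_eq_zero {E : Type*} [Zero E] {g : ℝ → E} {r : ℝ}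
    (hg : ∀ y, r < |y| → g y = 0) : HasCompactSupport g := by
  refine HasCompactSupport.intro (isCompact_closedBall (0 : ℝ) r) fun y hy => hg y ?_
  simpa using hy

/-- Poisson summation: the trigonometric sum is a periodization of the Fourier transform. -/
lemma trigSum_eq_tsum_fourier {g : ℝ → ℂ} (hg : ContDiff ℝ ∞ g) (hs : ∀ y, 1 < |y| → g y = 0)
    {t : ℝ} (ht : 0 < t) (θ : ℝ) :
    trigSum g t θ = ∑' n : ℤ, 𝓕 g (t * (n - θ / (2 * π))) := by
  let f : ℝ → ℂ := fun y => (t : ℂ)⁻¹ * g (y / t) * exp (y * θ * I)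
  have hf : ContDiff ℝ ∞ f := by
    refine (contDiff_const.mul (hg.comp (contDiff_id.div_const t))).mul (ContDiff.cexp ?_)
    exact (ofRealCLM.contDiff.mul contDiff_const).mul contDiff_const
  have hfs : ∀ y, t < |y| → f y = 0 := fun y hy => by
    have : 1 < |y / t| := by rwa [abs_div, abs_of_pos ht, one_lt_div ht]
    simp [f, hs _ this]
  let F : 𝓢(ℝ, ℂ) := (hasCompactSupport_of_eq_zero hfs).toSchwartzMap hf
  have hP := F.tsum_eq_tsum_fourier 0
  have hleft : ∑' n : ℤ, F (0 + n) = trigSum g t θ := by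
    rw [trigSum, tsum_eq_sum (s := Finset.Icc (-⌊t⌋) ⌊t⌋)]
    · refine Finset.sum_congr rfl fun k _ => ?_
      simp [F, f]
    · intro k hk
      rw [zero_add]
      refine hfs _ ?_
      rw [Finset.mem_Icc, ← abs_le, not_le, Int.floor_lt] at hk
      exact_mod_cast hk
  rw [← hleft, hP]
  refine tsum_congr fun n => ?_
  have h0 : fourier n ((0 : ℝ) : UnitAddCircle) = 1 := by simp
  rw [h0, mul_one, fourier_coe, Real.fourier_real_eq_integral_exp_smul,
    Real.fourier_real_eq_integral_exp_smul]
  have hcomp := Measure.integral_comp_div (fun y : ℝ =>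
    exp (↑(-2 * π * y * (t * (n - θ / (2 * π)))) * I) • g y) t
  rw [abs_of_pos ht] at hcomp
  have hpi : (π : ℂ) ≠ 0 := ofReal_ne_zero.2 Real.pi_ne_zero
  have ht' : (t : ℂ) ≠ 0 := ofReal_ne_zero.2 ht.ne'
  rw [← inv_smul_eq_iff₀ ht.ne', ← integral_smul] at hcomp
  rw [← hcomp]
  congr 1 with y
  have hexp : exp (↑(-2 * π * y * n) * I) * exp (y * θ * I)
      = exp (↑(-2 * π * (y / t) * (t * (n - θ / (2 * π)))) * I) := by
    rw [← Complex.exp_add]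
    congr 1
    push_cast
    field_simp
    ring
  rw [← hexp]
  simp [F, f]
  ring

lemma exists_fourier_decay {g : ℝ → ℂ} (hg : ContDiff ℝ ∞ g) (hs : ∀ y, 1 < |y| → g y = 0)
    (N : ℕ) : ∃ C, 0 ≤ C ∧ ∀ ξ, (1 + |ξ|) ^ N * ‖𝓕 g ξ‖ ≤ C := by
  let G : 𝓢(ℝ, ℂ) := (hasCompactSupport_of_eq_zero hs).toSchwartzMap hg
  have h := fun ξ => one_add_le_sup_seminorm_apply (𝕜 := ℝ) (m := (N, 0)) le_rfl le_rfl (𝓕 G) ξ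
  have h' := fun ξ => by simpa [G, fourier_coe] using h ξ
  refine ⟨_, le_trans ?_ (h' 0), h'⟩
  positivity

lemma summable_inv_one_add_abs_sq : Summable fun n : ℤ => ((1 + |(n : ℝ)|) ^ 2)⁻¹ := by
  have h : Summable fun n : ℤ => ((n : ℝ) ^ 2)⁻¹ := by
    simpa using Real.summable_one_div_int_pow.2 one_lt_two
  refine Summable.of_norm_bounded_eventually h ?_
  filter_upwards [(Set.finite_singleton (0 : ℤ)).compl_mem_cofinite] with n hn
  rw [norm_inv, norm_pow, Real.norm_eq_abs, abs_of_nonneg (by positivity), ← sq_abs (n : ℝ)]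
  have : 0 < |(n : ℝ)| := abs_pos.2 (Int.cast_ne_zero.2 hn)
  gcongr
  linarith

/-- The distances to the points of the lattice are bounded below by the nearest distance and
by the lattice index. -/
lemma abs_sub_lower_bounds {a : ℝ} (ha : 0 ≤ a) (ha' : a ≤ 1 / 6) (n : ℤ) :
    a ≤ |n - a| ∧ |(n : ℝ)| / 2 ≤ |n - a| := by
  rcases lt_trichotomy n 0 with h | rfl | h
  · have : (n : ℝ) ≤ -1 := by exact_mod_cast Int.le_sub_one_of_lt h
    rw [abs_of_nonpos (by linarith : (n : ℝ) - a ≤ 0), abs_of_nonpos (by linarith : (n : ℝ) ≤ 0)]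
    constructor <;> linarith
  · simp [abs_of_nonneg ha, ha]
  · have : (1 : ℝ) ≤ n := by exact_mod_cast h
    rw [abs_of_nonneg (by linarith : 0 ≤ (n : ℝ) - a), abs_of_nonneg (by linarith : 0 ≤ (n : ℝ))]
    constructor <;> linarith

lemma one_add_mul_pow_mul_le {t a : ℝ} (ht : 1 ≤ t) (ha : 0 ≤ a) (ha' : a ≤ 1 / 6) (N : ℕ)
    (n : ℤ) : (1 + t * a) ^ N * (1 + |(n : ℝ)|) ^ 2 ≤ 4 * (1 + |t * (n - a)|) ^ (N + 2) := by
  obtain ⟨h1, h2⟩ := abs_sub_lower_bounds ha ha' n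
  have ht0 : 0 ≤ t := by linarith
  rw [abs_mul, abs_of_nonneg ht0, pow_add]
  have h3 : |(n : ℝ) - a| ≤ t * |n - a| := le_mul_of_one_le_left (abs_nonneg _) ht
  have h4 : (1 + t * a) ^ N ≤ (1 + t * |n - a|) ^ N := by gcongr
  have h5 : (1 + |(n : ℝ)|) ^ 2 ≤ (2 * (1 + t * |n - a|)) ^ 2 := by
    gcongr
    linarith
  calc _ ≤ (1 + t * |n - a|) ^ N * (2 * (1 + t * |n - a|)) ^ 2 := by gcongr
    _ = _ := by ring

lemma norm_fourier_le_of_decay {g : ℝ → ℂ} {N : ℕ} {C : ℝ}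
    (hC : ∀ ξ, (1 + |ξ|) ^ (N + 2) * ‖𝓕 g ξ‖ ≤ C) {t a : ℝ} (ht : 1 ≤ t) (ha : 0 ≤ a)
    (ha' : a ≤ 1 / 6) (n : ℤ) :
    (1 + t * a) ^ N * ‖𝓕 g (t * (n - a))‖ ≤ 4 * C * ((1 + |(n : ℝ)|) ^ 2)⁻¹ := by
  rw [← div_eq_mul_inv, le_div_iff₀ (by positivity)]
  calc _ = ((1 + t * a) ^ N * (1 + |(n : ℝ)|) ^ 2) * ‖𝓕 g (t * (n - a))‖ := by ring
    _ ≤ (4 * (1 + |t * (n - a)|) ^ (N + 2)) * ‖𝓕 g (t * (n - a))‖ := by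
      gcongr ?_ * _
      exact one_add_mul_pow_mul_le ht ha ha' N n
    _ ≤ 4 * C := by rw [mul_assoc]; gcongr; exact hC _

/-- Rapid decay of the trigonometric sums, uniformly in the scale. -/
lemma exists_trigSum_bound {g : ℝ → ℂ} (hg : ContDiff ℝ ∞ g) (hs : ∀ y, 1 < |y| → g y = 0)
    (N : ℕ) : ∃ C, 0 ≤ C ∧ ∀ t θ, 1 ≤ t → 0 ≤ θ → θ ≤ π / 3 →
      (1 + t * θ) ^ N * ‖trigSum g t θ‖ ≤ C := by
  obtain ⟨C, hC0, hC⟩ := exists_fourier_decay hg hs (N + 2)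
  have hsum := summable_inv_one_add_abs_sq.mul_left (4 * C)
  refine ⟨(2 * π) ^ N * ∑' n : ℤ, 4 * C * ((1 + |(n : ℝ)|) ^ 2)⁻¹, ?_, fun t θ ht h0 h1 => ?_⟩
  · exact mul_nonneg (by positivity) (tsum_nonneg fun n => by positivity)
  have ha : 0 ≤ θ / (2 * π) := by positivity
  have ha' : θ / (2 * π) ≤ 1 / 6 := by
    rw [div_le_iff₀ (by positivity)]
    linarith
  have hb := norm_fourier_le_of_decay hC ht ha ha'
  have ht0 : 0 ≤ t := by linarith
  set a := θ / (2 * π) with ha_def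
  have hθ : θ = 2 * π * a := by rw [ha_def]; field_simp
  have h2 : (1 + t * θ) ^ N ≤ (2 * π) ^ N * (1 + t * a) ^ N := by
    rw [← mul_pow, hθ]
    gcongr
    nlinarith [Real.pi_gt_three]
  have h3 : (1 + t * a) ^ N * ‖trigSum g t θ‖ ≤ ∑' n : ℤ, 4 * C * ((1 + |(n : ℝ)|) ^ 2)⁻¹ := by
    have hK : ‖((1 + t * a) ^ N : ℝ) • trigSum g t θ‖ = (1 + t * a) ^ N * ‖trigSum g t θ‖ := by
      rw [norm_smul, Real.norm_of_nonneg (by positivity)]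
    rw [← hK, trigSum_eq_tsum_fourier hg hs (by linarith), ← ha_def, ← tsum_const_smul'']
    refine tsum_of_norm_bounded hsum.hasSum fun n => ?_
    rw [norm_smul, Real.norm_of_nonneg (by positivity)]
    exact hb n
  calc _ ≤ (2 * π) ^ N * (1 + t * a) ^ N * ‖trigSum g t θ‖ := by gcongr
    _ ≤ _ := by rw [mul_assoc]; gcongr

lemma summable_norm_fourier {g : ℝ → ℂ} (hg : ContDiff ℝ ∞ g) (hs : ∀ y, 1 < |y| → g y = 0)
    {t : ℝ} (ht : 0 < t) (a : ℝ) : Summable fun n : ℤ => ‖𝓕 g (t * (n - a))‖ := by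
  obtain ⟨C, hC0, hC⟩ := exists_fourier_decay hg hs 2
  refine Summable.of_nonneg_of_le (fun n => norm_nonneg _) (fun n => ?_)
    (summable_inv_one_add_abs_sq.mul_left ((1 + |a| + t⁻¹) ^ 2 * C))
  rw [← div_eq_mul_inv, le_div_iff₀ (by positivity)]
  have h1 : 1 + |(n : ℝ)| ≤ (1 + |a| + t⁻¹) * (1 + |t * (n - a)|) := by
    have h2 : |(n : ℝ)| ≤ |n - a| + |a| := by simpa using abs_add_le ((n : ℝ) - a) a
    have h3 : t⁻¹ * |t * (n - a)| = |n - a| := by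
      rw [abs_mul, abs_of_pos ht, inv_mul_cancel_left₀ ht.ne']
    have h4 : 0 ≤ t⁻¹ := by positivity
    nlinarith [abs_nonneg a, abs_nonneg (t * (n - a))]
  calc _ ≤ ‖𝓕 g (t * (n - a))‖ * ((1 + |a| + t⁻¹) * (1 + |t * (n - a)|)) ^ 2 := by gcongr
    _ = (1 + |a| + t⁻¹) ^ 2 * ((1 + |t * (n - a)|) ^ 2 * ‖𝓕 g (t * (n - a))‖) := by ring
    _ ≤ _ := by gcongr; exact hC _

open Polynomial in
/-- The polynomial in `x` which equals `t⁻¹ ∑ g(k/t) cos(kθ)` for `x = 2B(1 - cos θ)`. -/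
noncomputable def chebyshevSum (B : ℝ) (g : ℝ → ℝ) (t : ℝ) : ℝ[X] :=
  ∑ k ∈ Finset.Icc (-⌊t⌋) ⌊t⌋,
    C (t⁻¹ * g (k / t)) * (Chebyshev.T ℝ k).comp (1 - C (2 * B)⁻¹ * X)

lemma natDegree_chebyshevSum_le (B : ℝ) (g : ℝ → ℝ) {t : ℝ} (ht : 0 ≤ t) :
    ((chebyshevSum B g t).natDegree : ℝ) ≤ t := by
  refine le_trans (Nat.cast_le.2 ?_) (Nat.floor_le ht)
  refine Polynomial.natDegree_sum_le_of_forall_le _ _ fun k hk => ?_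
  refine (Polynomial.natDegree_C_mul_le _ _).trans (Polynomial.natDegree_comp_le.trans ?_)
  have h1 : (1 - Polynomial.C (2 * B)⁻¹ * Polynomial.X : Polynomial ℝ).natDegree ≤ 1 := by
    compute_degree
  have h2 : k.natAbs ≤ ⌊t⌋₊ := by
    rw [Finset.mem_Icc] at hk
    have := Int.natCast_floor_eq_floor ht
    omega
  rw [Polynomial.Chebyshev.natDegree_T]
  calc _ ≤ ⌊t⌋₊ * 1 := Nat.mul_le_mul h2 h1
    _ = _ := mul_one _

lemma eval_chebyshevSum {B : ℝ} (hB : B ≠ 0) (g : ℝ → ℝ) (t θ : ℝ) :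
    (chebyshevSum B g t).eval (2 * B * (1 - Real.cos θ))
      = (trigSum (fun y => (g y : ℂ)) t θ).re := by
  rw [chebyshevSum, trigSum, Polynomial.eval_finsetSum, re_sum]
  refine Finset.sum_congr rfl fun k _ => ?_
  have h1 : 1 - (2 * B)⁻¹ * (2 * B * (1 - Real.cos θ)) = Real.cos θ := by field_simp; ring
  simp only [Polynomial.eval_mul, Polynomial.eval_C, Polynomial.eval_comp, Polynomial.eval_sub,
    Polynomial.eval_one, Polynomial.eval_X, h1, Polynomial.Chebyshev.T_real_cos]
  have h2 : (k : ℂ) * θ * I = ((k * θ : ℝ) : ℂ) * I := by push_cast; ring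
  have h3 : (t : ℂ)⁻¹ * (g (k / t) : ℂ) = ((t⁻¹ * g (k / t) : ℝ) : ℂ) := by push_cast; rfl
  rw [h2, h3, re_ofReal_mul, exp_ofReal_mul_I_re]

/-- `tan (θ / 2)`, as the ratio of `x = 2B(1 - cos θ)` and its derivative. -/
lemma hasDerivAt_one_sub_cos_div_sin {θ : ℝ} (h : Real.sin θ ≠ 0) :
    HasDerivAt (fun θ => (1 - Real.cos θ) / Real.sin θ)
      ((1 + ((1 - Real.cos θ) / Real.sin θ) ^ 2) / 2) θ := by
  refine (((Real.hasDerivAt_cos θ).const_sub 1).div (Real.hasDerivAt_sin θ) h).congr_deriv ?_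
  have := Real.sin_sq_add_cos_sq θ
  field_simp
  linear_combination this

/-- In the angle variable, the Euler-type derivatives `x ^ ℓ P⁽ˡ⁾(x)` of a function whose
derivatives are `t ^ j R_j` are combinations of `(t τ) ^ j R_j`, with coefficients independent of
the function that are polynomials in `τ = tan (θ / 2)`. -/
lemma exists_pow_mul_iterate_derivative_eq (B : ℝ) (ℓ : ℕ) :
    ∃ q : ℕ → Polynomial ℝ, (∀ j, ℓ < j → q j = 0) ∧
      ∀ (P : Polynomial ℝ) (t : ℝ) (R : ℕ → ℝ → ℝ),
      (∀ j θ, HasDerivAt (R j) (t * R (j + 1) θ) θ) →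
      (∀ θ, P.eval (2 * B * (1 - Real.cos θ)) = R 0 θ) →
      ∀ θ ∈ Set.Ioo 0 π,
        (2 * B * (1 - Real.cos θ)) ^ ℓ *
            (Polynomial.derivative^[ℓ] P).eval (2 * B * (1 - Real.cos θ)) =
          ∑ j ∈ Finset.range (ℓ + 1), (t * ((1 - Real.cos θ) / Real.sin θ)) ^ j *
            (q j).eval ((1 - Real.cos θ) / Real.sin θ) * R j θ := by
  induction ℓ with
  | zero =>
    refine ⟨fun j => if j = 0 then 1 else 0, fun j hj => by simp [hj.ne'], ?_⟩
    intro P t R _ hP θ _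
    simp [hP]
  | succ ℓ ih =>
    obtain ⟨q, hq0, hq⟩ := ih
    let s : ℕ → Polynomial ℝ := fun j =>
      (Polynomial.C (j : ℝ) * q j + Polynomial.X * (q j).derivative) *
        (Polynomial.C (1 / 2) * (1 + Polynomial.X ^ 2)) - Polynomial.C (ℓ : ℝ) * q j
    refine ⟨fun j => s j + if j = 0 then 0 else q (j - 1), fun j hj => ?_, ?_⟩
    · have h1 : q j = 0 := hq0 j (by omega)
      have h2 : q (j - 1) = 0 := hq0 (j - 1) (by omega)
      simp [s, h1, h2]
    intro P t R hR hP θ hθ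
    have hsin : Real.sin θ ≠ 0 := (Real.sin_pos_of_mem_Ioo hθ).ne'
    have hτ := hasDerivAt_one_sub_cos_div_sin hsin
    set x : ℝ → ℝ := fun θ => 2 * B * (1 - Real.cos θ) with hx
    set τ : ℝ → ℝ := fun θ => (1 - Real.cos θ) / Real.sin θ with hτdef
    have hxd : HasDerivAt x (2 * B * Real.sin θ) θ := by
      refine (((Real.hasDerivAt_cos θ).const_sub 1).const_mul (2 * B)).congr_deriv ?_
      ring
    have hxτ : τ θ * (2 * B * Real.sin θ) = x θ := by
      simp only [hx, hτdef]
      field_simp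
    have hL := (hxd.fun_pow ℓ).fun_mul
      (((Polynomial.derivative^[ℓ] P).hasDerivAt (x θ)).comp θ hxd)
    have hS : HasDerivAt (fun θ => ∑ j ∈ Finset.range (ℓ + 1),
        (t * τ θ) ^ j * (q j).eval (τ θ) * R j θ) _ θ :=
      HasDerivAt.fun_sum fun j _ => ((((hτ.const_mul t).fun_pow j).fun_mul
        (((q j).hasDerivAt (τ θ)).comp θ hτ)).fun_mul (hR j θ))
    have heq : (fun θ => x θ ^ ℓ * ((fun y => (Polynomial.derivative^[ℓ] P).eval y) ∘ x) θ)
        =ᶠ[nhds θ] fun θ => ∑ j ∈ Finset.range (ℓ + 1),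
          (t * τ θ) ^ j * (q j).eval (τ θ) * R j θ := by
      filter_upwards [isOpen_Ioo.mem_nhds hθ] with y hy
      exact hq P t R hR hP y hy
    have hder := hL.unique (hS.congr_of_eventuallyEq heq)
    have hval := hq P t R hR hP θ hθ
    have hpow : ∀ (m : ℕ) (y : ℝ), y * (m * y ^ (m - 1)) = m * y ^ m := fun m y => by
      cases m with
      | zero => simp
      | succ m => simp [pow_succ]; ring
    have hs0 : s (ℓ + 1) = 0 := by simp [s, hq0 (ℓ + 1) (Nat.lt_succ_self ℓ)]
    have hright : ∑ j ∈ Finset.range (ℓ + 1 + 1), (t * τ θ) ^ j *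
          (s j + if j = 0 then 0 else q (j - 1)).eval (τ θ) * R j θ
        = ∑ j ∈ Finset.range (ℓ + 1), ((t * τ θ) ^ j * (s j).eval (τ θ) * R j θ
          + (t * τ θ) ^ (j + 1) * (q j).eval (τ θ) * R (j + 1) θ) := by
      simp only [Polynomial.eval_add, mul_add, add_mul, Finset.sum_add_distrib]
      congr 1
      · rw [Finset.sum_range_succ, hs0]
        simp
      · rw [Finset.sum_range_succ']
        simp
    have hleft : x θ ^ (ℓ + 1) * (Polynomial.derivative^[ℓ + 1] P).eval (x θ) =
        τ θ * (ℓ * x θ ^ (ℓ - 1) * (2 * B * Real.sin θ) * (Polynomial.derivative^[ℓ] P).eval (x θ)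
          + x θ ^ ℓ * ((Polynomial.derivative^[ℓ] P).derivative.eval (x θ) *
            (2 * B * Real.sin θ))) -
          ℓ * (x θ ^ ℓ * (Polynomial.derivative^[ℓ] P).eval (x θ)) := by
      rw [Function.iterate_succ_apply']
      linear_combination (-ℓ * x θ ^ (ℓ - 1) * (Polynomial.derivative^[ℓ] P).eval (x θ)
        - x θ ^ ℓ * (Polynomial.derivative^[ℓ] P).derivative.eval (x θ)) * hxτ
        - (Polynomial.derivative^[ℓ] P).eval (x θ) * hpow ℓ (x θ)
    rw [hright, hleft, hval]
    refine (congrArg (fun z => τ θ * z - _) hder).trans ?_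
    rw [Finset.mul_sum, Finset.mul_sum, ← Finset.sum_sub_distrib]
    refine Finset.sum_congr rfl fun j _ => ?_
    simp only [s, Polynomial.eval_add, Polynomial.eval_sub, Polynomial.eval_mul, Polynomial.eval_C,
      Polynomial.eval_X, Polynomial.eval_pow, Polynomial.eval_one]
    change τ θ * ((j * (t * τ θ) ^ (j - 1) * (t * ((1 + τ θ ^ 2) / 2)) * (q j).eval (τ θ)
      + (t * τ θ) ^ j * ((q j).derivative.eval (τ θ) * ((1 + τ θ ^ 2) / 2))) * R j θ
      + (t * τ θ) ^ j * (q j).eval (τ θ) * (t * R (j + 1) θ)) - _ = _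
    linear_combination (1 + τ θ ^ 2) / 2 * (q j).eval (τ θ) * R j θ * hpow j (t * τ θ)

lemma iteratedDeriv_polynomial_eval (P : Polynomial ℝ) (ℓ : ℕ) :
    iteratedDeriv ℓ (fun x => P.eval x) = fun x => (Polynomial.derivative^[ℓ] P).eval x := by
  induction ℓ with
  | zero => simp
  | succ ℓ ih =>
    rw [iteratedDeriv_succ, ih, Function.iterate_succ_apply']
    ext x
    exact Polynomial.deriv _

lemma exists_angle {B x : ℝ} (hB : 0 < B) (hx : 0 < x) (hxB : x ≤ B) :
    ∃ θ, 0 < θ ∧ θ ≤ π / 3 ∧ 2 * B * (1 - Real.cos θ) = x := by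
  have h1 : 0 < x / (2 * B) := by positivity
  have h2 : x / (2 * B) ≤ 1 / 2 := by
    rw [div_le_iff₀ (by positivity)]
    linarith
  have hcos : Real.cos (Real.arccos (1 - x / (2 * B))) = 1 - x / (2 * B) :=
    Real.cos_arccos (by linarith) (by linarith)
  refine ⟨Real.arccos (1 - x / (2 * B)), Real.arccos_pos.2 (by linarith), ?_, ?_⟩
  · by_contra! h
    have := Real.cos_lt_cos_of_nonneg_of_le_pi (by positivity) (Real.arccos_le_pi _) h
    rw [hcos, Real.cos_pi_div_three] at this
    linarith
  · rw [hcos]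
    field_simp
    ring

lemma one_sub_cos_div_sin_bounds {θ : ℝ} (h0 : 0 < θ) (h1 : θ ≤ π / 3) :
    0 ≤ (1 - Real.cos θ) / Real.sin θ ∧ (1 - Real.cos θ) / Real.sin θ ≤ θ ∧
      (1 - Real.cos θ) / Real.sin θ ≤ 1 := by
  have hpi := Real.pi_pos
  have hpi' := Real.pi_lt_d2
  have hs : 2 / π * θ ≤ Real.sin θ := Real.mul_le_sin h0.le (by linarith)
  have hs0 : 0 < Real.sin θ := lt_of_lt_of_le (by positivity) hs
  have hc : 1 - Real.cos θ ≤ θ ^ 2 / 2 := by linarith [Real.one_sub_sq_div_two_le_cos (x := θ)]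
  have h2 : π / 6 ≤ 2 / π := by
    rw [div_le_div_iff₀ (by norm_num) hpi]
    nlinarith
  have h3 : 1 / 2 ≤ 2 / π := by
    rw [div_le_div_iff₀ (by norm_num) hpi]
    linarith
  refine ⟨div_nonneg (by linarith [Real.cos_le_one θ]) hs0.le, ?_, ?_⟩
  · rw [div_le_iff₀ hs0]
    nlinarith [mul_le_mul_of_nonneg_right h3 h0.le]
  · rw [div_le_iff₀ hs0]
    nlinarith [mul_le_mul_of_nonneg_right h2 h0.le]

lemma exists_chebyshevSum_bound {B : ℝ} (hB : 0 < B) {g : ℝ → ℝ} (hg : ContDiff ℝ ∞ g)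
    (hs : ∀ y, 1 < |y| → g y = 0) (ℓ n : ℕ) :
    ∃ C, ∀ t, 1 ≤ t → ∀ x ∈ Set.Ioo 0 B, (1 + t ^ 2 * x) ^ n * x ^ ℓ *
      |(Polynomial.derivative^[ℓ] (chebyshevSum B g t)).eval x| ≤ C := by
  let G : ℕ → ℝ → ℂ := fun j y => (I * y) ^ j * g y
  have hG : ∀ j, ContDiff ℝ ∞ (G j) := fun j =>
    ((contDiff_const.mul ofRealCLM.contDiff).pow j).mul (ofRealCLM.contDiff.comp hg)
  have hGs : ∀ j y, 1 < |y| → G j y = 0 := fun j y hy => by simp [G, hs y hy]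
  choose C hC0 hC using fun j => exists_trigSum_bound (hG j) (hGs j) (2 * n + j)
  obtain ⟨q, -, hq⟩ := exists_pow_mul_iterate_derivative_eq B ℓ
  have hcompact : ∀ j, ∃ K, ∀ y ∈ Set.Icc (0 : ℝ) 1, ‖(q j).eval y‖ ≤ K := fun j =>
    isCompact_Icc.exists_bound_of_continuousOn (q j).continuous.continuousOn
  choose K hK using hcompact
  refine ⟨(1 + B) ^ n * ∑ j ∈ Finset.range (ℓ + 1), K j * C j, fun t ht x hx => ?_⟩
  obtain ⟨θ, h0, h1, rfl⟩ := exists_angle hB hx.1 hx.2.le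
  obtain ⟨hτ0, hτθ, hτ1⟩ := one_sub_cos_div_sin_bounds h0 h1
  have ht0 : 0 < t := by linarith
  have hR : ∀ j θ, HasDerivAt (fun θ => (trigSum (G j) t θ).re)
      (t * (trigSum (G (j + 1)) t θ).re) θ := fun j θ => by
    have h := reCLM.hasFDerivAt.comp_hasDerivAt θ (hasDerivAt_trigSum (G j) ht0.ne' θ)
    have hsucc : (fun y : ℝ => I * y * G j y) = G (j + 1) := by
      ext y
      simp only [G]
      ring
    rw [hsucc] at h
    refine h.congr_deriv ?_
    simp
  have hG0 : G 0 = fun y => (g y : ℂ) := by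
    ext y
    simp [G]
  have key := hq (chebyshevSum B g t) t (fun j θ => (trigSum (G j) t θ).re) hR
    (fun θ => by rw [eval_chebyshevSum hB.ne', hG0]) θ ⟨h0, by linarith [Real.pi_pos]⟩
  set x := 2 * B * (1 - Real.cos θ) with hxdef
  set τ := (1 - Real.cos θ) / Real.sin θ with hτ
  have hxθ : x ≤ B * θ ^ 2 := by
    rw [hxdef]
    nlinarith [Real.one_sub_sq_div_two_le_cos (x := θ)]
  have hx0 : 0 < x := hx.1
  have hweight : (1 + t ^ 2 * x) ^ n ≤ (1 + B) ^ n * (1 + t * θ) ^ (2 * n) := by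
    rw [pow_mul, ← mul_pow]
    gcongr
    have h2 : t ^ 2 * x ≤ t ^ 2 * (B * θ ^ 2) := by gcongr
    have h3 : 0 < t * θ := by positivity
    nlinarith [mul_pos hB h3, mul_pos h3 h3]
  have habs : x ^ ℓ * |(Polynomial.derivative^[ℓ] (chebyshevSum B g t)).eval x|
      = |∑ j ∈ Finset.range (ℓ + 1), (t * τ) ^ j * (q j).eval τ * (trigSum (G j) t θ).re| := by
    rw [← key, abs_mul, abs_of_pos (pow_pos hx0 ℓ)]
  rw [mul_assoc, habs]
  calc _ ≤ ((1 + B) ^ n * (1 + t * θ) ^ (2 * n)) * ∑ j ∈ Finset.range (ℓ + 1),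
        |(t * τ) ^ j * (q j).eval τ * (trigSum (G j) t θ).re| := by
        gcongr
        exact Finset.abs_sum_le_sum_abs _ _
    _ = (1 + B) ^ n * ∑ j ∈ Finset.range (ℓ + 1), (1 + t * θ) ^ (2 * n) *
        |(t * τ) ^ j * (q j).eval τ * (trigSum (G j) t θ).re| := by
        rw [mul_assoc, Finset.mul_sum]
    _ ≤ _ := by
        refine mul_le_mul_of_nonneg_left (Finset.sum_le_sum fun j _ => ?_) (by positivity)
        rw [abs_mul, abs_mul, abs_of_nonneg (by positivity : 0 ≤ (t * τ) ^ j)]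
        have h4 : (t * τ) ^ j ≤ (1 + t * θ) ^ j := by
          gcongr
          nlinarith
        have h5 : |(q j).eval τ| ≤ K j := hK j τ ⟨hτ0, hτ1⟩
        have h6 := abs_re_le_norm (trigSum (G j) t θ)
        have hK0 : 0 ≤ K j := (abs_nonneg _).trans h5
        calc _ ≤ (1 + t * θ) ^ (2 * n) * ((1 + t * θ) ^ j * K j * ‖trigSum (G j) t θ‖) := by
              gcongr
          _ = K j * ((1 + t * θ) ^ (2 * n + j) * ‖trigSum (G j) t θ‖) := by ring
          _ ≤ _ := by
              gcongr
              exact hC j t θ ht h0.le h1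

lemma hasSum_eval_chebyshevSum {B : ℝ} (hB : B ≠ 0) {g φ : ℝ → ℝ} (hg : ContDiff ℝ ∞ g)
    (hs : ∀ y, 1 < |y| → g y = 0) (hφ : ∀ ξ, 𝓕 (fun y => (g y : ℂ)) ξ = φ ξ) {t : ℝ}
    (ht : 0 < t) (θ : ℝ) :
    HasSum (fun n : ℤ => φ (t * (n - θ / (2 * π))))
      ((chebyshevSum B g t).eval (2 * B * (1 - Real.cos θ))) := by
  have hgc : ContDiff ℝ ∞ fun y => (g y : ℂ) := ofRealCLM.contDiff.comp hg
  have hsc : ∀ y, 1 < |y| → (g y : ℂ) = 0 := fun y hy => by simp [hs y hy]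
  have h := (summable_norm_fourier hgc hsc ht (θ / (2 * π))).of_norm.hasSum
  rw [← trigSum_eq_tsum_fourier hgc hsc ht θ] at h
  rw [eval_chebyshevSum hB]
  simpa [hφ] using hasSum_re h

/-- A function with smooth, compactly supported inverse Fourier transform is a Schwartz function. -/
lemma exists_schwartzMap_eq_of_fourier_eq {g φ : ℝ → ℝ} (hg : ContDiff ℝ ∞ g)
    (hs : ∀ y, 1 < |y| → g y = 0) (hφ : ∀ ξ, 𝓕 (fun y => (g y : ℂ)) ξ = φ ξ) :
    ∃ F : 𝓢(ℝ, ℂ), ∀ ξ, F ξ = φ ξ := by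
  have hgc : ContDiff ℝ ∞ fun y => (g y : ℂ) := ofRealCLM.contDiff.comp hg
  have hsc : ∀ y, 1 < |y| → (g y : ℂ) = 0 := fun y hy => by simp [hs y hy]
  refine ⟨𝓕 ((hasCompactSupport_of_eq_zero hsc).toSchwartzMap hgc), fun ξ => ?_⟩
  rw [fourier_coe]
  exact hφ ξ

lemma continuous_of_fourier_eq {g φ : ℝ → ℝ} (hg : ContDiff ℝ ∞ g)
    (hs : ∀ y, 1 < |y| → g y = 0) (hφ : ∀ ξ, 𝓕 (fun y => (g y : ℂ)) ξ = φ ξ) :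
    Continuous φ := by
  obtain ⟨F, hF⟩ := exists_schwartzMap_eq_of_fourier_eq hg hs hφ
  have : φ = fun ξ => (F ξ).re := by
    ext ξ
    simp [hF]
  rw [this]
  exact continuous_re.comp F.continuous

lemma integrable_id_mul_of_fourier_eq {g φ : ℝ → ℝ} (hg : ContDiff ℝ ∞ g)
    (hs : ∀ y, 1 < |y| → g y = 0) (hφ : ∀ ξ, 𝓕 (fun y => (g y : ℂ)) ξ = φ ξ) :
    Integrable fun s => s * φ s := by
  have hcont : Continuous φ := continuous_of_fourier_eq hg hs hφ
  obtain ⟨F, hF⟩ := exists_schwartzMap_eq_of_fourier_eq hg hs hφ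
  refine (F.integrable_pow_mul volume 1).mono' (by fun_prop)
    (Filter.Eventually.of_forall fun s => ?_)
  simp [hF]

lemma integral_mul_chebyshevSum {B : ℝ} (hB : B ≠ 0) {g φ : ℝ → ℝ} (hg : ContDiff ℝ ∞ g)
    (hs : ∀ y, 1 < |y| → g y = 0) (hφ : ∀ ξ, 𝓕 (fun y => (g y : ℂ)) ξ = φ ξ)
    (hφ0 : ∀ ξ, 0 ≤ φ ξ) (heven : ∀ ξ, φ (-ξ) = φ ξ) {θ : ℝ} (hθ : Real.sin (θ / 2) ≠ 0) :
    ∫ t in Set.Ioi (0 : ℝ), t * (chebyshevSum B g t).eval (2 * B * (1 - Real.cos θ))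
      = (∫ s in Set.Ioi (0 : ℝ), s * φ s) * (π ^ 2 / Real.sin (θ / 2) ^ 2) := by
  have hI := (integrable_id_mul_of_fourier_eq hg hs hφ).integrableOn (s := Set.Ioi (0 : ℝ))
  set J := ∫ s in Set.Ioi (0 : ℝ), s * φ s
  set a := θ / (2 * π) with ha
  have hπa : π * a = θ / 2 := by
    rw [ha]
    field_simp
  have hsum := hasSum_inv_sub_intCast_sq (a := a) (by rwa [hπa])
  rw [hπa] at hsum
  have hne : ∀ n : ℤ, 0 < |(n : ℝ) - a| := fun n => by
    rw [abs_pos, sub_ne_zero]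
    intro h
    refine hθ (Real.sin_eq_zero_iff.2 ⟨n, ?_⟩)
    rw [← hπa, h, mul_comm]
  have hscale : ∀ (n : ℤ) (t : ℝ), t * φ (t * (n - a))
      = |(n : ℝ) - a|⁻¹ * ((|(n : ℝ) - a| * t) * φ (|(n : ℝ) - a| * t)) := fun n t => by
    have h1 : φ (t * (n - a)) = φ (|(n : ℝ) - a| * t) := by
      rcases abs_choice ((n : ℝ) - a) with h | h
      · rw [h, mul_comm]
      · rw [h, ← heven]
        congr 1
        ring
    rw [h1, mul_assoc, inv_mul_cancel_left₀ (hne n).ne']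
  have hint : ∀ n : ℤ, IntegrableOn (fun t : ℝ => t * φ (t * (n - a))) (Set.Ioi 0) := fun n => by
    simp only [hscale n]
    refine Integrable.const_mul ?_ _
    refine (integrableOn_Ioi_comp_mul_left_iff (fun s => s * φ s) 0 (hne n)).2 ?_
    rwa [mul_zero]
  have hval : ∀ n : ℤ, ∫ t in Set.Ioi (0 : ℝ), t * φ (t * (n - a)) = J * ((a - n) ^ 2)⁻¹ :=
    fun n => by
      simp only [hscale n]
      rw [integral_const_mul, integral_comp_mul_left_Ioi (fun s => s * φ s) 0 (hne n), mul_zero,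
        smul_eq_mul, ← mul_assoc, ← mul_inv, ← sq, sq_abs, mul_comm J, ← neg_sq (a - (n : ℝ)),
        neg_sub]
  have hnorm : ∀ n : ℤ, ∫ t in Set.Ioi (0 : ℝ), ‖t * φ (t * (n - a))‖ = J * ((a - n) ^ 2)⁻¹ :=
    fun n => by
      rw [← hval n]
      refine setIntegral_congr_fun measurableSet_Ioi fun t ht => ?_
      exact Real.norm_of_nonneg (mul_nonneg (le_of_lt ht) (hφ0 _))
  have hS := hasSum_integral_of_summable_integral_norm hint
    (by simpa only [hnorm] using hsum.summable.mul_left J)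
  simp only [hval] at hS
  rw [← hS.unique (hsum.mul_left J)]
  refine setIntegral_congr_fun measurableSet_Ioi fun t ht => ?_
  rw [tsum_mul_left, (hasSum_eval_chebyshevSum hB hg hs hφ ht θ).tsum_eq]

lemma eval_chebyshevSum_of_lt_one (B : ℝ) (g : ℝ → ℝ) {t : ℝ} (h0 : 0 ≤ t) (h1 : t < 1) (x : ℝ) :
    (chebyshevSum B g t).eval x = t⁻¹ * g 0 := by
  have : ⌊t⌋ = 0 := Int.floor_eq_zero_iff.2 ⟨h0, h1⟩
  simp [chebyshevSum, this]

/-- **Bauerschmidt's decomposition lemma with lower bound.** For every `B > 0` there is a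
family `W_t ∈ C^∞(ℝ)` (`t > 0`), each `W_t` a polynomial of degree at most `t`, with
(i) `λ⁻¹ = ∫₀^∞ t W_t(λ) dt` on `(0,B)`, (ii) `W_t ≥ 0` on `(0,B)`,
(iii) `(1+t²λ)^n λ^ℓ |∂_λ^ℓ W_t(λ)| ≤ C_{ℓ,n}` on `(0,B)` and
(iv) `W_t(λ) ≥ ε` for `0 < λ ≤ B·min(1, t⁻²)`. -/
theorem stmt5 (B : ℝ) (hB : 0 < B) :
    ∃ W : ℝ → ℝ → ℝ,
      (∀ t, 0 < t → ContDiff ℝ (⊤ : ℕ∞) (W t)) ∧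
      (∀ t, 0 < t → ∃ P : Polynomial ℝ, (P.natDegree : ℝ) ≤ t ∧ ∀ x, W t x = P.eval x) ∧
      (∀ x ∈ Set.Ioo (0 : ℝ) B, ∫ t in Set.Ioi (0 : ℝ), t * W t x = x⁻¹) ∧
      (∀ t, 0 < t → ∀ x ∈ Set.Ioo (0 : ℝ) B, 0 ≤ W t x) ∧
      (∀ ℓ n : ℕ, ∃ C : ℝ, ∀ t, 0 < t → ∀ x ∈ Set.Ioo (0 : ℝ) B,
        (1 + t ^ 2 * x) ^ n * x ^ ℓ * |iteratedDeriv ℓ (W t) x| ≤ C) ∧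
      (∃ ε : ℝ, 0 < ε ∧ ∀ t, 0 < t → ∀ x : ℝ, 0 < x → x ≤ B * min 1 (t ^ 2)⁻¹ →
        ε ≤ W t x) := by
  obtain ⟨g, φ, hg, hs, hφ, hφ0, heven, hpos⟩ := exists_contDiff_fourier_nonneg
  have hI := integrable_id_mul_of_fourier_eq hg hs hφ
  have hcont : Continuous φ := continuous_of_fourier_eq hg hs hφ
  have hsum := fun {t : ℝ} (ht : 0 < t) => hasSum_eval_chebyshevSum hB.ne' hg hs hφ ht
  have hnn : ∀ t, 0 < t → ∀ x ∈ Set.Ioc 0 B, 0 ≤ (chebyshevSum B g t).eval x := by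
    intro t ht x hx
    obtain ⟨θ, -, -, rfl⟩ := exists_angle hB hx.1 hx.2
    exact (hsum ht θ).nonneg fun n => hφ0 _
  have hlow : ∀ t, 0 < t → ∀ x, 0 < x → x ≤ B * min 1 (t ^ 2)⁻¹ →
      ∃ ξ ∈ Set.Icc (-(1 / 4) : ℝ) (1 / 4), φ ξ ≤ (chebyshevSum B g t).eval x := by
    intro t ht x hx hxB
    have hx1 : x ≤ B := hxB.trans (mul_le_of_le_one_right hB.le (min_le_left _ _))
    have hx2 : x ≤ B * (t ^ 2)⁻¹ := hxB.trans (by gcongr; exact min_le_right _ _)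
    obtain ⟨θ, h0, h1, rfl⟩ := exists_angle hB hx hx1
    refine ⟨t * (((0 : ℤ) : ℝ) - θ / (2 * π)), abs_le.1 ?_,
      le_hasSum (hsum ht θ) 0 fun n _ => hφ0 _⟩
    have hcos := Real.cos_le_one_sub_mul_cos_sq (x := θ)
      (by rw [abs_of_pos h0]; linarith [Real.pi_pos])
    rw [← div_eq_mul_inv, le_div_iff₀ (by positivity)] at hx2
    have h2 : 2 / π ^ 2 * θ ^ 2 ≤ 1 - Real.cos θ := by linarith
    have h3 : 2 * (1 - Real.cos θ) * t ^ 2 ≤ 1 := by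
      refine le_of_mul_le_mul_left (?_ : B * _ ≤ B * 1) hB
      linarith
    have h4 : (t * (θ / (2 * π))) ^ 2 ≤ (1 / 4) ^ 2 := by
      have h5 : 2 * (2 / π ^ 2 * θ ^ 2) * t ^ 2 ≤ 1 := le_trans (by gcongr) h3
      have h6 : (t * (θ / (2 * π))) ^ 2 = 2 * (2 / π ^ 2 * θ ^ 2) * t ^ 2 / 16 := by
        field_simp
        ring
      rw [h6]
      linarith
    rw [Int.cast_zero, zero_sub, mul_neg, abs_neg]
    exact abs_le_of_sq_le_sq h4 (by norm_num)
  obtain ⟨ξ₀, hξ₀, hmin⟩ := (isCompact_Icc (a := -(1 / 4 : ℝ)) (b := 1 / 4)).exists_isMinOn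
    ⟨0, by norm_num⟩ hcont.continuousOn
  have hm : 0 < φ ξ₀ := hpos _ (abs_le.2 hξ₀)
  have hlow' : ∀ t, 0 < t → ∀ x, 0 < x → x ≤ B * min 1 (t ^ 2)⁻¹ →
      φ ξ₀ ≤ (chebyshevSum B g t).eval x := fun t ht x hx hxB => by
    obtain ⟨ξ, hξ, hle⟩ := hlow t ht x hx hxB
    exact (hmin hξ).trans hle
  have hg0 : φ ξ₀ ≤ 2 * g 0 := by
    have h := hlow' (1 / 2) (by norm_num) B hB (by norm_num)
    rw [eval_chebyshevSum_of_lt_one B g (by norm_num) (by norm_num)] at h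
    linarith
  set J := ∫ s in Set.Ioi (0 : ℝ), s * φ s with hJdef
  have hJ : 0 < J := by
    refine (setIntegral_pos_iff_support_of_nonneg_ae ?_ hI.integrableOn).2 ?_
    · filter_upwards [ae_restrict_mem measurableSet_Ioi] with s hs
      exact mul_nonneg (le_of_lt hs) (hφ0 s)
    · refine lt_of_lt_of_le ?_ (measure_mono (?_ : Set.Ioo (0 : ℝ) (1 / 4) ⊆ _))
      · simp
      · intro s hs
        refine ⟨(mul_pos hs.1 (hpos s ?_)).ne', hs.1⟩
        rw [abs_of_pos hs.1]
        exact hs.2.le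
  set N := 4 * π ^ 2 * B * J with hN
  have hN0 : 0 < N := by positivity
  have hint : ∀ x ∈ Set.Ioo 0 B,
      ∫ t in Set.Ioi (0 : ℝ), t * (chebyshevSum B g t).eval x = N * x⁻¹ := by
    intro x hx
    obtain ⟨θ, h0, h1, rfl⟩ := exists_angle hB hx.1 hx.2.le
    have hsin : Real.sin (θ / 2) ≠ 0 :=
      (Real.sin_pos_of_pos_of_lt_pi (by linarith) (by linarith [Real.pi_pos])).ne'
    rw [integral_mul_chebyshevSum hB.ne' hg hs hφ hφ0 heven hsin, ← hJdef, hN]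
    have hsq : 2 * Real.sin (θ / 2) ^ 2 = 1 - Real.cos θ := by
      have h2 := Real.cos_two_mul (θ / 2)
      have h3 := Real.sin_sq_add_cos_sq (θ / 2)
      rw [mul_div_cancel₀ θ two_ne_zero] at h2
      linarith
    rw [← hsq]
    field_simp
    ring
  let Q : ℝ → Polynomial ℝ := fun t =>
    if t < 1 then Polynomial.C (2 * g 0 / N) else Polynomial.C N⁻¹ * chebyshevSum B g t
  have hQ0 : ∀ t, t < 1 → Q t = Polynomial.C (2 * g 0 / N) := fun t ht => if_pos ht
  have hQ1 : ∀ t, 1 ≤ t → Q t = Polynomial.C N⁻¹ * chebyshevSum B g t :=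
    fun t ht => if_neg ht.not_gt
  have hQe : ∀ t, 1 ≤ t → ∀ x, (Q t).eval x = (chebyshevSum B g t).eval x / N :=
    fun t ht x => by
      rw [hQ1 t ht, Polynomial.eval_mul, Polynomial.eval_C, div_eq_inv_mul]
  have hQc : ∀ t, t < 1 → ∀ x, (Q t).eval x = 2 * g 0 / N := fun t ht x => by
    rw [hQ0 t ht, Polynomial.eval_C]
  have hc : φ ξ₀ / N ≤ 2 * g 0 / N := by gcongr
  refine ⟨fun t x => (Q t).eval x, fun t _ => (Q t).contDiff_aeval _,
    fun t ht => ⟨Q t, ?_, fun _ => rfl⟩, fun x hx => ?_, fun t ht x hx => ?_, fun ℓ n => ?_,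
    φ ξ₀ / N, by positivity, fun t ht x hx hxB => ?_⟩
  · rcases lt_or_ge t 1 with h | h
    · rw [hQ0 t h, Polynomial.natDegree_C]
      simpa using ht.le
    · rw [hQ1 t h]
      refine le_trans ?_ (natDegree_chebyshevSum_le B g ht.le)
      exact_mod_cast Polynomial.natDegree_C_mul_le _ _
  · have hx0 := hx.1
    have hF : IntegrableOn (fun t => t * (chebyshevSum B g t).eval x) (Set.Ioi 0) := by
      refine not_imp_comm.1 integral_undef ?_
      rw [hint x hx]
      positivity
    have hsplit : Set.Ioi (0 : ℝ) = Set.Ioo 0 1 ∪ Set.Ici 1 :=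
      (Set.Ioo_union_Ici_eq_Ioi zero_lt_one).symm
    have hdisj : Disjoint (Set.Ioo (0 : ℝ) 1) (Set.Ici 1) :=
      Set.disjoint_left.2 fun t h1 h2 => absurd h1.2 (not_lt.2 h2)
    have hF1 : IntegrableOn (fun t => t * (chebyshevSum B g t).eval x) (Set.Ici 1) :=
      hF.mono_set (hsplit ▸ Set.subset_union_right)
    have hF0 : IntegrableOn (fun t => t * (chebyshevSum B g t).eval x) (Set.Ioo 0 1) :=
      hF.mono_set (hsplit ▸ Set.subset_union_left)
    have hW1 : Set.EqOn (fun t => t * (Q t).eval x)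
        (fun t => t * (chebyshevSum B g t).eval x / N) (Set.Ici 1) := fun t ht => by
      simp only [hQe t ht, mul_div_assoc]
    have hW0 : Set.EqOn (fun t => t * (Q t).eval x) (fun t => t * (2 * g 0 / N)) (Set.Ioo 0 1) :=
      fun t ht => by simp only [hQc t ht.2]
    have hI0 : ∫ t in Set.Ioo (0 : ℝ) 1, t * (chebyshevSum B g t).eval x = g 0 := by
      rw [setIntegral_congr_fun (g := fun _ => g 0) measurableSet_Ioo fun t ht => ?_]
      · simp
      · simp only [eval_chebyshevSum_of_lt_one B g ht.1.le ht.2, mul_inv_cancel_left₀ ht.1.ne']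
    have hI1 : ∫ t in Set.Ioo (0 : ℝ) 1, t * (2 * g 0 / N) = g 0 / N := by
      rw [integral_mul_const, ← integral_Ioc_eq_integral_Ioo,
        ← intervalIntegral.integral_of_le zero_le_one, integral_id]
      ring
    have hJ1 := hint x hx
    rw [hsplit, setIntegral_union hdisj measurableSet_Ici hF0 hF1, hI0] at hJ1
    have hlin : IntegrableOn (fun t : ℝ => t * (2 * g 0 / N)) (Set.Ioo 0 1) :=
      ((by fun_prop : Continuous fun t : ℝ => t * (2 * g 0 / N)).integrableOn_Icc
        (a := 0) (b := 1)).mono_set Set.Ioo_subset_Icc_self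
    rw [hsplit, setIntegral_union hdisj measurableSet_Ici
      (hlin.congr_fun hW0.symm measurableSet_Ioo)
      (IntegrableOn.congr_fun (hF1.div_const N) hW1.symm measurableSet_Ici),
      setIntegral_congr_fun measurableSet_Ioo hW0, setIntegral_congr_fun measurableSet_Ici hW1,
      hI1, integral_div, ← add_div, hJ1]
    field_simp
  · rcases lt_or_ge t 1 with h | h
    · simp only [hQc t h]
      exact le_trans (by positivity) hc
    · simp only [hQe t h]
      exact div_nonneg (hnn t ht x ⟨hx.1, hx.2.le⟩) hN0.le
  · obtain ⟨C, hC⟩ := exists_chebyshevSum_bound hB hg hs ℓ n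
    refine ⟨max ((1 + B) ^ n * B ^ ℓ * |2 * g 0 / N|) (C / N), fun t ht x hx => ?_⟩
    have hx0 := hx.1
    rw [iteratedDeriv_polynomial_eval]
    beta_reduce
    rcases lt_or_ge t 1 with h | h
    · refine le_trans ?_ (le_max_left _ _)
      have h1 : t ^ 2 * x ≤ 1 * B := mul_le_mul (pow_le_one₀ ht.le h.le) hx.2.le hx0.le one_pos.le
      have h2 : |(Polynomial.derivative^[ℓ] (Q t)).eval x| ≤ |2 * g 0 / N| := by
        rw [hQ0 t h]
        cases ℓ with
        | zero => simp
        | succ ℓ => simp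
      have h3 : x ≤ B := hx.2.le
      gcongr
      linarith
    · refine le_trans ?_ (le_max_right _ _)
      rw [hQ1 t h, Polynomial.iterate_derivative_C_mul, Polynomial.eval_mul, Polynomial.eval_C,
        abs_mul, abs_of_pos (inv_pos.2 hN0), div_eq_inv_mul, mul_left_comm]
      gcongr
      exact hC t h x hx
  · rcases lt_or_ge t 1 with h | h
    · simpa only [hQc t h] using hc
    · simp only [hQe t h]
      gcongr
      exact hlow' t ht x hx hxB
end

section
/- Let X be a vector of n independent standard normal random variables and let A ∈ ℝ^{n×n}. Then for every real s₀ ≥ 2 there is a constant C(s₀), independent of n and A, such that for all real s with 1 ≤ s ≤ s₀, E|⟨X, AX⟩ − tr A|^s ≤ C(s₀) ‖A‖_HS^s. -/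
open MeasureTheory Matrix ProbabilityTheory
open scoped Matrix

/-- The law of a vector of `n` independent standard normal random variables:
the product of `n` copies of the standard Gaussian on `ℝ`. -/
noncomputable def stdGaussian (n : ℕ) : Measure (Fin n → ℝ) :=
  Measure.pi fun _ : Fin n => gaussianReal 0 1

/-- The Hilbert–Schmidt (Frobenius) norm `‖A‖_HS = √(tr (A Aᵀ))`. -/
noncomputable def hsNorm {n : ℕ} (A : Matrix (Fin n) (Fin n) ℝ) : ℝ :=
  Real.sqrt (Matrix.trace (A * Aᵀ))

lemma exp_neg_sub_sq_le_one_sub {v : ℝ} (hv : |v| ≤ 1 / 2) : Real.exp (-v - v ^ 2) ≤ 1 - v := by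
  obtain ⟨h1, h2⟩ := abs_le.mp hv
  have hpos : 0 < 1 - v := by linarith
  have key : 1 ≤ (1 - v) * Real.exp (v + v ^ 2) := by
    rcases le_total v 0 with h | h
    · have := Real.add_one_le_exp (v + v ^ 2)
      nlinarith [pow_nonneg (neg_nonneg.mpr h) 3]
    · have := Real.quadratic_le_exp_of_nonneg (x := v + v ^ 2) (by positivity)
      have h3 : 0 ≤ v ^ 2 * ((1 + v) ^ 2 * (1 - v) / 2 - v) := by
        apply mul_nonneg (sq_nonneg v)
        nlinarith [mul_nonneg h h, mul_nonneg (mul_nonneg h h) (sub_nonneg.mpr h2)]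
      nlinarith
  have : Real.exp (-v - v ^ 2) = (Real.exp (v + v ^ 2))⁻¹ := by
    rw [← Real.exp_neg]; ring_nf
  rw [this, inv_le_iff_one_le_mul₀ (Real.exp_pos _)]
  exact key

lemma gaussianPDFReal_mul_exp_sq (u x : ℝ) :
    gaussianPDFReal 0 1 x * Real.exp (u * (x ^ 2 - 1)) =
      (√(2 * Real.pi))⁻¹ * Real.exp (-u) * Real.exp (-(1 / 2 - u) * x ^ 2) := by
  simp only [gaussianPDFReal, NNReal.coe_one, mul_one, sub_zero]
  rw [mul_assoc, mul_assoc, ← Real.exp_add, ← Real.exp_add]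
  ring_nf

lemma integrable_exp_mul_sq_sub_one {u : ℝ} (hu : u < 1 / 2) :
    Integrable (fun x : ℝ => Real.exp (u * (x ^ 2 - 1))) (gaussianReal 0 1) := by
  rw [gaussianReal_of_var_ne_zero 0 one_ne_zero,
    integrable_withDensity_iff_integrable_smul' (by fun_prop) (by simp [gaussianPDF])]
  simp only [toReal_gaussianPDF, smul_eq_mul, gaussianPDFReal_mul_exp_sq]
  exact (integrable_exp_neg_mul_sq (by linarith)).const_mul _

lemma integral_exp_mul_sq_sub_one_le {u : ℝ} (hu : |u| ≤ 1 / 4) :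
    ∫ x : ℝ, Real.exp (u * (x ^ 2 - 1)) ∂(gaussianReal 0 1) ≤ Real.exp (2 * u ^ 2) := by
  have hu' : 0 < 1 - 2 * u := by linarith [(abs_le.mp hu).2]
  rw [integral_gaussianReal_eq_integral_smul one_ne_zero]
  simp only [smul_eq_mul, gaussianPDFReal_mul_exp_sq]
  rw [integral_const_mul, integral_gaussian]
  have h1 : (√(2 * Real.pi))⁻¹ * Real.exp (-u) * √(Real.pi / (1 / 2 - u)) =
      Real.exp (-u) * (√(1 - 2 * u))⁻¹ := by
    have : Real.pi / (1 / 2 - u) = (2 * Real.pi) * (1 - 2 * u)⁻¹ := by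
      have : (1 / 2 - u) ≠ 0 := by linarith
      field_simp
    rw [this, Real.sqrt_mul (x := 2 * Real.pi) (by positivity), Real.sqrt_inv]
    have : √(2 * Real.pi) ≠ 0 := by positivity
    field_simp
  rw [h1, ← div_eq_mul_inv, div_le_iff₀ (by positivity)]
  have h2 := exp_neg_sub_sq_le_one_sub (v := 2 * u) (by
    rw [abs_mul, abs_two]; linarith)
  have h3 : Real.exp (-u - 2 * u ^ 2) ≤ √(1 - 2 * u) := by
    apply Real.le_sqrt_of_sq_le
    rw [← Real.exp_nat_mul]
    convert h2 using 2
    push_cast; ring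
  calc Real.exp (-u) = Real.exp (2 * u ^ 2) * Real.exp (-u - 2 * u ^ 2) := by
        rw [← Real.exp_add]; ring_nf
    _ ≤ _ := by gcongr

section FiniteIndex

variable {ι : Type*} [Fintype ι]

lemma exp_mul_sum_eq_prod (t : ℝ) (l x : ι → ℝ) :
    Real.exp (t * ∑ i, l i * (x i ^ 2 - 1)) = ∏ i, Real.exp (t * l i * (x i ^ 2 - 1)) := by
  rw [← Real.exp_sum, Finset.mul_sum]
  simp only [mul_assoc]

lemma integrable_exp_mul_weighted_sum {t : ℝ} {l : ι → ℝ} (h : ∀ i, |t * l i| ≤ 1 / 4) :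
    Integrable (fun x : ι → ℝ => Real.exp (t * ∑ i, l i * (x i ^ 2 - 1)))
      (Measure.pi fun _ => gaussianReal 0 1) := by
  simp only [exp_mul_sum_eq_prod]
  exact Integrable.fintype_prod (f := fun i y => Real.exp (t * l i * (y ^ 2 - 1)))
    fun i => integrable_exp_mul_sq_sub_one (by linarith [(abs_le.mp (h i)).2])

lemma integral_exp_mul_weighted_sum_le {t : ℝ} {l : ι → ℝ} (h : ∀ i, |t * l i| ≤ 1 / 4) :
    ∫ x : ι → ℝ, Real.exp (t * ∑ i, l i * (x i ^ 2 - 1))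
      ∂(Measure.pi fun _ => gaussianReal 0 1) ≤ Real.exp (2 * t ^ 2 * ∑ i, l i ^ 2) := by
  simp only [exp_mul_sum_eq_prod]
  rw [integral_fintype_prod_eq_prod (fun i y => Real.exp (t * l i * (y ^ 2 - 1))),
    Finset.mul_sum, Real.exp_sum]
  refine Finset.prod_le_prod (fun i _ => integral_nonneg fun _ => (Real.exp_pos _).le)
    fun i _ => (integral_exp_mul_sq_sub_one_le (h i)).trans_eq ?_
  ring_nf

lemma rpow_le_mul_exp_div_four {N : ℕ} {s y : ℝ} (hs : 0 ≤ s) (hsN : s ≤ N) (hy : 0 ≤ y) :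
    y ^ s ≤ (1 + 4 ^ N * N.factorial) * Real.exp (y / 4) := by
  have h1 : y ^ s ≤ 1 + y ^ N := by
    rcases le_total y 1 with h | h
    · linarith [Real.rpow_le_one hy h hs, pow_nonneg hy N]
    · have := Real.rpow_le_rpow_of_exponent_le h hsN
      rw [Real.rpow_natCast] at this
      linarith
  have h2 := Real.pow_div_factorial_le_exp (x := y / 4) (by positivity) N
  have h3 : y ^ N ≤ 4 ^ N * N.factorial * Real.exp (y / 4) := by
    rw [div_pow, div_div, div_le_iff₀ (by positivity)] at h2
    linarith
  linarith [Real.one_le_exp (x := y / 4) (by positivity)]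

lemma integral_abs_weighted_sum_rpow_le {N : ℕ} {s h : ℝ} (hs : 0 ≤ s) (hsN : s ≤ N) (hh : 0 < h)
    {l : ι → ℝ} (hl : ∑ i, l i ^ 2 ≤ h ^ 2) :
    ∫ x : ι → ℝ, |∑ i, l i * (x i ^ 2 - 1)| ^ s ∂(Measure.pi fun _ => gaussianReal 0 1) ≤
      (1 + 4 ^ N * N.factorial) * (2 * Real.exp (1 / 8)) * h ^ s := by
  set K : ℝ := 1 + 4 ^ N * N.factorial with hK
  have hK0 : 0 ≤ K := by positivity
  have hli (i : ι) : |l i| ≤ h := by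
    refine abs_le_of_sq_le_sq ?_ hh.le
    exact (Finset.single_le_sum (f := fun i => l i ^ 2) (fun _ _ => sq_nonneg _)
      (Finset.mem_univ i)).trans hl
  have hbound (t : ℝ) (ht : |t| = (4 * h)⁻¹) (i : ι) : |t * l i| ≤ 1 / 4 := by
    rw [abs_mul, ht, inv_mul_le_iff₀ (by positivity)]
    linarith [hli i]
  have hint (t : ℝ) (ht : |t| = (4 * h)⁻¹) :
      ∫ x : ι → ℝ, Real.exp (t * ∑ i, l i * (x i ^ 2 - 1))
        ∂(Measure.pi fun _ => gaussianReal 0 1) ≤ Real.exp (1 / 8) := by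
    refine (integral_exp_mul_weighted_sum_le (hbound t ht)).trans (Real.exp_le_exp.mpr ?_)
    have : t ^ 2 * h ^ 2 = 1 / 16 := by
      rw [← sq_abs t, ht]; field_simp; norm_num
    nlinarith [mul_le_mul_of_nonneg_left hl (sq_nonneg t)]
  have hp : |(4 * h)⁻¹| = (4 * h)⁻¹ := abs_of_pos (by positivity)
  have hm : |-(4 * h)⁻¹| = (4 * h)⁻¹ := by rw [abs_neg, hp]
  have hip := integrable_exp_mul_weighted_sum (hbound _ hp)
  have him := integrable_exp_mul_weighted_sum (hbound _ hm)
  calc _ ≤ ∫ x : ι → ℝ, h ^ s * K * (Real.exp ((4 * h)⁻¹ * ∑ i, l i * (x i ^ 2 - 1)) +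
        Real.exp (-(4 * h)⁻¹ * ∑ i, l i * (x i ^ 2 - 1)))
        ∂(Measure.pi fun _ => gaussianReal 0 1) := by
        refine integral_mono_of_nonneg (.of_forall fun x => by positivity)
          ((hip.add him).const_mul _) (.of_forall fun x => ?_)
        dsimp only
        set Q := ∑ i, l i * (x i ^ 2 - 1)
        have h1 : |Q| ^ s = h ^ s * (|Q| / h) ^ s := by
          rw [← Real.mul_rpow hh.le (by positivity), mul_div_cancel₀ _ hh.ne']
        rw [h1, mul_assoc]
        gcongr
        refine (rpow_le_mul_exp_div_four hs hsN (by positivity)).trans ?_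
        gcongr
        have h2 : |Q| / h / 4 = |(4 * h)⁻¹ * Q| := by
          rw [abs_mul, hp]; field_simp
        rw [h2, neg_mul]
        exact Real.exp_abs_le _
    _ = h ^ s * K * (∫ x : ι → ℝ, Real.exp ((4 * h)⁻¹ * ∑ i, l i * (x i ^ 2 - 1))
          ∂(Measure.pi fun _ => gaussianReal 0 1) +
        ∫ x : ι → ℝ, Real.exp (-(4 * h)⁻¹ * ∑ i, l i * (x i ^ 2 - 1))
          ∂(Measure.pi fun _ => gaussianReal 0 1)) := by
        rw [integral_const_mul, integral_add hip him]
    _ ≤ h ^ s * K * (Real.exp (1 / 8) + Real.exp (1 / 8)) := by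
        gcongr
        · exact hint _ hp
        · exact hint _ hm
    _ = _ := by ring

lemma map_orthonormalBasis_pi_gaussianReal (b : OrthonormalBasis ι ℝ (EuclideanSpace ℝ ι)) :
    (Measure.pi fun _ : ι => gaussianReal 0 1).map (fun x => (∑ i, x i • b i).ofLp) =
      Measure.pi fun _ : ι => gaussianReal 0 1 := by
  have h := (stdGaussian_eq_map_pi_orthonormalBasis b).symm.trans
    (map_pi_eq_stdGaussian (ι := ι)).symm
  have h' := congrArg (Measure.map (WithLp.ofLp (p := 2) (V := ι → ℝ))) h
  rw [Measure.map_map (by fun_prop) (by fun_prop),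
    Measure.map_map (by fun_prop) (by fun_prop)] at h'
  simpa [Function.comp_def] using h'

lemma trace_symmetrization_sq_le (A : Matrix ι ι ℝ) :
    trace (((1 / 2 : ℝ) • (A + Aᵀ)) * ((1 / 2 : ℝ) • (A + Aᵀ))) ≤ trace (A * Aᵀ) := by
  have h : 0 ≤ trace ((A - Aᵀ) * (A - Aᵀ)ᵀ) := by
    simp only [trace, diag_apply, mul_apply, transpose_apply]
    exact Finset.sum_nonneg fun i _ => Finset.sum_nonneg fun j _ => mul_self_nonneg _
  have h1 : trace (Aᵀ * A) = trace (A * Aᵀ) := trace_mul_comm _ _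
  have h2 : trace (Aᵀ * Aᵀ) = trace (A * A) := by rw [← transpose_mul, trace_transpose]
  simp only [transpose_sub, transpose_transpose, Matrix.mul_sub, Matrix.sub_mul, trace_sub, h1,
    h2] at h
  simp only [Matrix.smul_mul, Matrix.mul_smul, Matrix.mul_add, Matrix.add_mul, trace_smul,
    trace_add, h1, h2, smul_eq_mul]
  linarith

lemma dotProduct_mulVec_symmetrization (A : Matrix ι ι ℝ) (x : ι → ℝ) :
    x ⬝ᵥ ((1 / 2 : ℝ) • (A + Aᵀ)) *ᵥ x = x ⬝ᵥ A *ᵥ x := by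
  have h : x ⬝ᵥ Aᵀ *ᵥ x = x ⬝ᵥ A *ᵥ x := by
    rw [mulVec_transpose, dotProduct_comm, dotProduct_mulVec]
  rw [smul_mulVec, dotProduct_smul, add_mulVec, dotProduct_add, h, smul_eq_mul]
  ring

variable [DecidableEq ι]

lemma eigenvectorUnitary_transpose_mul_mul {S : Matrix ι ι ℝ} (hS : S.IsHermitian) :
    (hS.eigenvectorUnitary : Matrix ι ι ℝ)ᵀ * S * (hS.eigenvectorUnitary : Matrix ι ι ℝ) =
      diagonal hS.eigenvalues := by
  have h := hS.conjStarAlgAut_star_eigenvectorUnitary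
  simpa [Unitary.conjStarAlgAut_apply, star_eq_conjTranspose] using h

lemma dotProduct_mulVec_eigenvectorBasis {S : Matrix ι ι ℝ} (hS : S.IsHermitian) (x : ι → ℝ) :
    (∑ i, x i • hS.eigenvectorBasis i).ofLp ⬝ᵥ S *ᵥ (∑ i, x i • hS.eigenvectorBasis i).ofLp =
      ∑ i, hS.eigenvalues i * x i ^ 2 := by
  have h : (∑ i, x i • hS.eigenvectorBasis i).ofLp =
      (hS.eigenvectorUnitary : Matrix ι ι ℝ) *ᵥ x := by
    ext j
    simp [mulVec, dotProduct, Matrix.IsHermitian.eigenvectorUnitary_apply, mul_comm]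
  rw [h, ← vecMul_transpose, ← dotProduct_mulVec, vecMul_transpose, mulVec_mulVec, mulVec_mulVec,
    eigenvectorUnitary_transpose_mul_mul hS]
  simp only [dotProduct, mulVec_diagonal]
  exact Finset.sum_congr rfl fun i _ => by ring

lemma sum_sq_eigenvalues {S : Matrix ι ι ℝ} (hS : S.IsHermitian) :
    ∑ i, hS.eigenvalues i ^ 2 = trace (S * S) := by
  have h := eigenvectorUnitary_transpose_mul_mul hS
  have hU : (hS.eigenvectorUnitary : Matrix ι ι ℝ) * (hS.eigenvectorUnitary : Matrix ι ι ℝ)ᵀ = 1 := by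
    simpa [star_eq_conjTranspose] using Unitary.coe_mul_star_self hS.eigenvectorUnitary
  set U := (hS.eigenvectorUnitary : Matrix ι ι ℝ)
  calc _ = trace (diagonal hS.eigenvalues * diagonal hS.eigenvalues) := by
        simp [diagonal_mul_diagonal, trace_diagonal, sq]
    _ = trace (Uᵀ * (S * (U * Uᵀ) * S * U)) := by rw [← h]; simp only [Matrix.mul_assoc]
    _ = _ := by rw [hU, trace_mul_comm, Matrix.mul_one, Matrix.mul_assoc, hU, Matrix.mul_one]

end FiniteIndex

/-- **Whittle's moment bound for Gaussian quadratic forms.** For every `s₀ ≥ 2` there is a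
constant `C(s₀)`, independent of the dimension `n` and of the matrix `A`, such that for all
`1 ≤ s ≤ s₀`, `E|⟨X, AX⟩ − tr A|^s ≤ C(s₀)‖A‖_HS^s` for a standard Gaussian vector `X`. -/
theorem stmt10 (s₀ : ℝ) (hs₀ : 2 ≤ s₀) :
    ∃ C : ℝ, ∀ (n : ℕ) (A : Matrix (Fin n) (Fin n) ℝ) (s : ℝ), 1 ≤ s → s ≤ s₀ →
      ∫ x : Fin n → ℝ, |x ⬝ᵥ A *ᵥ x - Matrix.trace A| ^ s ∂(stdGaussian n) ≤
        C * hsNorm A ^ s := by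
  refine ⟨(1 + 4 ^ ⌈s₀⌉₊ * (⌈s₀⌉₊).factorial) * (2 * Real.exp (1 / 8)), fun n A s hs1 hs => ?_⟩
  have htr : 0 ≤ trace (A * Aᵀ) := by
    simp only [trace, diag_apply, mul_apply, transpose_apply]
    exact Finset.sum_nonneg fun i _ => Finset.sum_nonneg fun j _ => mul_self_nonneg _
  rcases (Real.sqrt_nonneg (trace (A * Aᵀ))).eq_or_lt' with h0 | hpos
  · have hA : A = 0 := by
      rw [Real.sqrt_eq_zero htr, ← conjTranspose_eq_transpose_of_trivial,
        trace_mul_conjTranspose_self_eq_zero_iff] at h0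
      exact h0
    have hs0 : s ≠ 0 := by linarith
    simp [hA, hsNorm, Real.zero_rpow hs0]
  set S : Matrix (Fin n) (Fin n) ℝ := (1 / 2 : ℝ) • (A + Aᵀ) with hSdef
  have hS : S.IsHermitian := by
    simp [IsHermitian, hSdef, conjTranspose_eq_transpose_of_trivial, add_comm]
  have htrS : trace A = ∑ i, hS.eigenvalues i := by
    have h := hS.trace_eq_sum_eigenvalues
    simp only [RCLike.ofReal_real_eq_id, id] at h
    rw [← h, hSdef, trace_smul, trace_add, trace_transpose, smul_eq_mul]
    ring
  have hl : ∑ i, hS.eigenvalues i ^ 2 ≤ hsNorm A ^ 2 := by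
    rw [sum_sq_eigenvalues, hsNorm, Real.sq_sqrt htr]
    exact trace_symmetrization_sq_le A
  have hmeas : Measurable fun x : Fin n → ℝ => |x ⬝ᵥ A *ᵥ x - Matrix.trace A| ^ s := by
    simp only [dotProduct, mulVec]
    fun_prop
  rw [_root_.stdGaussian, ← map_orthonormalBasis_pi_gaussianReal hS.eigenvectorBasis,
    integral_map (Measurable.aemeasurable (by fun_prop)) hmeas.aestronglyMeasurable]
  refine le_of_eq_of_le ?_ (integral_abs_weighted_sum_rpow_le (by linarith)
    (hs.trans (Nat.le_ceil s₀)) hpos hl)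
  congr 1 with x
  rw [← dotProduct_mulVec_symmetrization, dotProduct_mulVec_eigenvectorBasis hS, htrS,
    ← Finset.sum_sub_distrib]
  simp only [mul_sub, mul_one]
end

section
/- Let A, B ∈ ℝ^{m×m} be symmetric matrices, let λ_1 ≤ … ≤ λ_m be the eigenvalues of A counted with multiplicity, let ℓ ≥ 0 be an integer, and let f be a real polynomial. Then ‖(d^ℓ/ds^ℓ) f(A + sB)|_{s=0}‖ ≤ m^{ℓ+1} · sup_{λ ∈ [λ_1, λ_m]} |f^{(ℓ)}(λ)| · ‖B‖^ℓ, where f(A+sB) is the evaluation of the polynomial f at the matrix A+sB, f^{(ℓ)} is the ℓ-th derivative of f, and ‖·‖ is the operator norm. -/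
open Matrix
open scoped Matrix

attribute [local instance] Matrix.normedAddCommGroup Matrix.normedSpace

/-- The `ℓ²`-operator norm of a real square matrix. -/
noncomputable def opNorm {m : ℕ} (M : Matrix (Fin m) (Fin m) ℝ) : ℝ :=
  ‖Matrix.toEuclideanCLM (𝕜 := ℝ) M‖

open Polynomial in
theorem Polynomial.exists_eq_C_eval_add_X_sub_C_mul (f : ℝ[X]) (x : ℝ) :
    ∃ q : ℝ[X], f = C (f.eval x) + (X - C x) * q := by
  obtain ⟨q, hq⟩ := X_sub_C_dvd_sub_C_eval (a := x) (p := f)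
  exact ⟨q, by rw [← hq]; ring⟩

open Polynomial in
theorem Polynomial.iterate_derivative_C_add_X_sub_C_mul (c x : ℝ) (q : ℝ[X]) (k : ℕ) :
    derivative^[k + 1] (C c + (X - C x) * q) =
      (X - C x) * derivative^[k + 1] q + (k + 1 : ℝ[X]) * derivative^[k] q := by
  induction k with
  | zero => simp; ring
  | succ k ih =>
    rw [Function.iterate_succ_apply', ih]
    simp only [derivative_add, derivative_mul, ← Function.iterate_succ_apply' derivative]
    simp
    ring

/-- First-order condition at a maximum point `y` of `h` over `[a, b]`. -/
theorem IsMaxOn.deriv_mul_sub_nonpos {a b x y h' : ℝ} {h : ℝ → ℝ}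
    (hmax : IsMaxOn h (Set.Icc a b) y) (hx : x ∈ Set.Icc a b) (hy : y ∈ Set.Icc a b)
    (hd : HasDerivAt h h' y) : h' * (x - y) ≤ 0 := by
  have := IsLocalMaxOn.hasFDerivWithinAt_nonpos hmax.localize
    (hd.hasFDerivAt.hasFDerivWithinAt)
    (sub_mem_posTangentConeAt_of_segment_subset ((convex_Icc a b).segment_subset hy hx))
  simpa [mul_comm] using this

open Polynomial in
/-- The mean value inequality for the derivatives of a first divided difference, upper bound. -/
theorem Polynomial.iterate_derivative_eval_le_of_eq_C_add {a b x c M : ℝ} {q : ℝ[X]} {k : ℕ}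
    (hx : x ∈ Set.Icc a b)
    (hM : ∀ y ∈ Set.Icc a b, (derivative^[k + 1] (C c + (X - C x) * q)).eval y ≤ M) :
    ∀ y ∈ Set.Icc a b, (derivative^[k] q).eval y ≤ M / (k + 1) := by
  obtain ⟨y, hy, hmax⟩ := isCompact_Icc.exists_isMaxOn ⟨x, hx⟩
    (derivative^[k] q).continuous.continuousOn
  intro z hz
  refine (hmax hz).trans ?_
  have hd := hmax.deriv_mul_sub_nonpos hx hy (Polynomial.hasDerivAt _ y)
  have hy' := hM y hy
  rw [iterate_derivative_C_add_X_sub_C_mul, Function.iterate_succ_apply'] at hy'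
  simp only [eval_add, eval_mul, eval_sub, eval_X, eval_C, eval_natCast, eval_one] at hy'
  rw [le_div_iff₀ (by positivity)]
  linarith

open Polynomial in
/-- The mean value inequality for the derivatives of a first divided difference. -/
theorem Polynomial.abs_iterate_derivative_eval_le_of_eq_C_add {a b x c M : ℝ} {q : ℝ[X]} {k : ℕ}
    (hx : x ∈ Set.Icc a b)
    (hM : ∀ y ∈ Set.Icc a b, |(derivative^[k + 1] (C c + (X - C x) * q)).eval y| ≤ M) :
    ∀ y ∈ Set.Icc a b, |(derivative^[k] q).eval y| ≤ M / (k + 1) := by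
  intro y hy
  refine abs_le'.2 ⟨iterate_derivative_eval_le_of_eq_C_add hx
    (fun z hz => (le_abs_self _).trans (hM z hz)) y hy, ?_⟩
  have key := iterate_derivative_eval_le_of_eq_C_add (c := -c) (q := -q) (k := k) (M := M) hx
    (fun z hz => ?_) y hy
  · simpa [iterate_derivative_neg] using key
  · have h : C (-c) + (X - C x) * -q = -(C c + (X - C x) * q) := by rw [C_neg]; ring
    rw [h, iterate_derivative_neg, eval_neg]
    exact (neg_le_abs _).trans (hM z hz)

theorem iteratedDeriv_succ_id_smul {E : Type*} [NormedAddCommGroup E] [NormedSpace ℝ E]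
    {G : ℝ → E} (hG : ContDiff ℝ ⊤ G) (n : ℕ) :
    iteratedDeriv (n + 1) (fun s => s • G s) =
      fun s => s • iteratedDeriv (n + 1) G s + (n + 1 : ℝ) • iteratedDeriv n G s := by
  have hd (k : ℕ) : Differentiable ℝ (iteratedDeriv k G) :=
    hG.differentiable_iteratedDeriv k (by exact_mod_cast WithTop.coe_lt_top _)
  induction n with
  | zero =>
    funext s
    rw [zero_add, iteratedDeriv_one, iteratedDeriv_one]
    have := ((hasDerivAt_id s).smul (hG.differentiable (by simp) s).hasDerivAt).deriv
    simpa [Pi.smul_def'] using this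
  | succ n ih =>
    funext s
    rw [iteratedDeriv_succ, ih]
    have h := (((hasDerivAt_id s).smul (hd (n + 1) s).hasDerivAt).add
      ((hd n s).hasDerivAt.const_smul (n + 1 : ℝ))).deriv
    rw [← iteratedDeriv_succ, ← iteratedDeriv_succ] at h
    refine h.trans ?_
    push_cast
    simp only [id]
    module

section Resolution

variable {𝔸 ι : Type*} [NormedRing 𝔸] [NormedAlgebra ℝ 𝔸] [Fintype ι]

theorem contDiff_aeval_add_smul (A B : 𝔸) (f : Polynomial ℝ) {n : WithTop ℕ∞} :
    ContDiff ℝ n (fun s : ℝ => Polynomial.aeval (A + s • B) f) := by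
  simp_rw [Polynomial.aeval_eq_sum_range]
  fun_prop

open Polynomial in
/-- Multiplying by a spectral projection trades one derivative of `f (A + s B)` for a factor `B`
and a divided difference. -/
theorem mul_iteratedDeriv_aeval_of_eq_C_add {A P : 𝔸} (B : 𝔸) {x c : ℝ} {f q : ℝ[X]}
    (hP : P * A = x • P) (hf : f = C c + (X - C x) * q) (n : ℕ) :
    P * iteratedDeriv (n + 1) (fun s : ℝ => aeval (A + s • B) f) 0 =
      (n + 1 : ℝ) • (P * B * iteratedDeriv n (fun s : ℝ => aeval (A + s • B) q) 0) := by
  have key : (fun s : ℝ => P * aeval (A + s • B) f) =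
      fun s : ℝ => c • P + s • (P * B * aeval (A + s • B) q) := by
    funext s
    rw [hf]
    simp only [map_add, map_mul, map_sub, aeval_C, aeval_X, Algebra.algebraMap_eq_smul_one]
    simp only [mul_add, add_mul, sub_mul, mul_sub, ← mul_assoc, hP, mul_smul_comm, mul_one,
      smul_mul_assoc, one_mul]
    abel
  rw [← iteratedDeriv_const_mul P (contDiff_aeval_add_smul A B f).contDiffAt, key,
    iteratedDeriv_const_add (Nat.succ_pos n),
    iteratedDeriv_succ_id_smul (contDiff_const.mul (contDiff_aeval_add_smul A B q))]
  simp only [zero_smul, zero_add]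
  rw [iteratedDeriv_const_mul _ (contDiff_aeval_add_smul A B q).contDiffAt]

open Polynomial in
theorem norm_iteratedDeriv_aeval_add_smul_le {A : 𝔸} (B : 𝔸) {P : ι → 𝔸} {ev : ι → ℝ} {a b : ℝ}
    (hsum : ∑ i, P i = 1) (hnorm : ∀ i, ‖P i‖ ≤ 1) (hPA : ∀ i, P i * A = ev i • P i)
    (hev : ∀ i, ev i ∈ Set.Icc a b) (ℓ : ℕ) (f : ℝ[X]) {M : ℝ}
    (hM : ∀ x ∈ Set.Icc a b, |(derivative^[ℓ] f).eval x| ≤ M) :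
    ‖iteratedDeriv ℓ (fun s : ℝ => aeval (A + s • B) f) 0‖ ≤
      (Fintype.card ι : ℝ) ^ (ℓ + 1) * M * ‖B‖ ^ ℓ := by
  have reduce (T : 𝔸) (K : ℝ) (h : ∀ i, ‖P i * T‖ ≤ K) : ‖T‖ ≤ Fintype.card ι * K := by
    calc ‖T‖ = ‖∑ i, P i * T‖ := by rw [← Finset.sum_mul, hsum, one_mul]
      _ ≤ ∑ _i : ι, K := norm_sum_le_of_le _ fun i _ => h i
      _ = Fintype.card ι * K := by simp
  induction ℓ generalizing f M with
  | zero =>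
    simp only [iteratedDeriv_zero, zero_smul, add_zero, zero_add, pow_one, pow_zero, mul_one]
    refine reduce _ _ fun i => ?_
    obtain ⟨q, hq⟩ := exists_eq_C_eval_add_X_sub_C_mul f (ev i)
    have : P i * aeval A f = f.eval (ev i) • P i := by
      conv_lhs => rw [hq]
      simp only [map_add, map_mul, map_sub, aeval_C, aeval_X, Algebra.algebraMap_eq_smul_one]
      simp [mul_add, mul_sub, ← mul_assoc, hPA]
    rw [this, norm_smul, Real.norm_eq_abs]
    have := hM _ (hev i)
    exact (mul_le_of_le_one_right (abs_nonneg _) (hnorm i)).trans this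
  | succ ℓ ih =>
    rw [pow_succ' _ (ℓ + 1), mul_assoc, mul_assoc]
    refine reduce _ _ fun i => ?_
    obtain ⟨q, hq⟩ := exists_eq_C_eval_add_X_sub_C_mul f (ev i)
    have hq' := ih q (abs_iterate_derivative_eval_le_of_eq_C_add (hev i) (hq ▸ hM))
    rw [mul_iteratedDeriv_aeval_of_eq_C_add B (hPA i) hq, norm_smul, Real.norm_eq_abs,
      abs_of_nonneg (by positivity)]
    calc (ℓ + 1 : ℝ) * ‖P i * B * iteratedDeriv ℓ (fun s : ℝ => aeval (A + s • B) q) 0‖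
        ≤ (ℓ + 1 : ℝ) * (‖B‖ * (Fintype.card ι ^ (ℓ + 1) * (M / (ℓ + 1)) * ‖B‖ ^ ℓ)) := by
          gcongr
          refine (norm_mul_le _ _).trans ?_
          gcongr
          exact (norm_mul_le _ _).trans (mul_le_of_le_one_left (norm_nonneg _) (hnorm i))
      _ = _ := by field_simp; ring

end Resolution

theorem Matrix.IsHermitian.rankOne_mul_toEuclideanCLM {m : ℕ} {A : Matrix (Fin m) (Fin m) ℝ}
    (hA : A.IsHermitian) (i : Fin m) :
    InnerProductSpace.rankOne ℝ (hA.eigenvectorBasis i) (hA.eigenvectorBasis i) *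
        Matrix.toEuclideanCLM (𝕜 := ℝ) A =
      hA.eigenvalues i •
        InnerProductSpace.rankOne ℝ (hA.eigenvectorBasis i) (hA.eigenvectorBasis i) := by
  ext1 x
  have h : inner ℝ (hA.eigenvectorBasis i) (Matrix.toEuclideanCLM (𝕜 := ℝ) A x) =
      hA.eigenvalues i * inner ℝ (hA.eigenvectorBasis i) x := by
    have hs := Matrix.isSymmetric_toEuclideanLin_iff.mpr hA (hA.eigenvectorBasis i) x
    have he : Matrix.toEuclideanLin A (hA.eigenvectorBasis i) =
        hA.eigenvalues i • hA.eigenvectorBasis i := by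
      ext j
      exact congrFun (hA.mulVec_eigenvectorBasis i) j
    rw [he, real_inner_smul_left] at hs
    exact hs.symm
  simp [h, smul_smul]

theorem OrthonormalBasis.sum_rankOne_self {ι E : Type*} [Fintype ι] [NormedAddCommGroup E]
    [InnerProductSpace ℝ E] (b : OrthonormalBasis ι ℝ E) :
    ∑ i, InnerProductSpace.rankOne ℝ (b i) (b i) = 1 := by
  ext1 x
  simpa using b.sum_repr' x

theorem ContinuousLinearEquiv.iteratedDeriv_comp_left {E F : Type*} [NormedAddCommGroup E]
    [NormedSpace ℝ E] [NormedAddCommGroup F] [NormedSpace ℝ F] (Φ : E ≃L[ℝ] F) (g : ℝ → E)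
    (n : ℕ) (x : ℝ) : iteratedDeriv n (Φ ∘ g) x = Φ (iteratedDeriv n g x) := by
  rw [iteratedDeriv_eq_iteratedFDeriv, iteratedDeriv_eq_iteratedFDeriv,
    Φ.iteratedFDeriv_comp_left]
  rfl

theorem toEuclideanCLM_iteratedDeriv_aeval {m : ℕ} (A B : Matrix (Fin m) (Fin m) ℝ) (ℓ : ℕ)
    (f : Polynomial ℝ) :
    Matrix.toEuclideanCLM (𝕜 := ℝ) (iteratedDeriv ℓ (fun s : ℝ =>
        (Polynomial.aeval (A + s • B) f : Matrix (Fin m) (Fin m) ℝ)) 0) =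
      iteratedDeriv ℓ (fun s : ℝ => Polynomial.aeval (Matrix.toEuclideanCLM (𝕜 := ℝ) A +
        s • Matrix.toEuclideanCLM (𝕜 := ℝ) B) f) 0 := by
  let Φ : Matrix (Fin m) (Fin m) ℝ ≃L[ℝ]
      (EuclideanSpace ℝ (Fin m) →L[ℝ] EuclideanSpace ℝ (Fin m)) :=
    (Matrix.toEuclideanCLM (𝕜 := ℝ) (n := Fin m)).toAlgEquiv.toLinearEquiv.toContinuousLinearEquiv
  have hΦ : (fun s : ℝ => Polynomial.aeval (Matrix.toEuclideanCLM (𝕜 := ℝ) A +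
        s • Matrix.toEuclideanCLM (𝕜 := ℝ) B) f) =
      Φ ∘ fun s : ℝ => (Polynomial.aeval (A + s • B) f : Matrix (Fin m) (Fin m) ℝ) := by
    funext s
    have := Polynomial.aeval_algHom_apply
      (Matrix.toEuclideanCLM (𝕜 := ℝ) (n := Fin m)).toAlgEquiv.toAlgHom (A + s • B) f
    refine Eq.trans ?_ this
    congr 2
    exact ((map_add _ _ _).trans (congrArg _ (map_smul _ _ _))).symm
  rw [hΦ]
  exact (Φ.iteratedDeriv_comp_left _ _ _).symm

/-- **Derivative bound for polynomial functions of symmetric matrices.** If `A, B` are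
symmetric with eigenvalues `λ₁ ≤ … ≤ λ_m` of `A`, and `f` is a real polynomial, then
`‖(d^ℓ/ds^ℓ) f(A+sB)|_{s=0}‖ ≤ m^{ℓ+1} sup_{λ∈[λ₁,λ_m]} |f^{(ℓ)}(λ)| ‖B‖^ℓ`. -/
theorem stmt11 (m : ℕ) (hm : 1 ≤ m) (A B : Matrix (Fin m) (Fin m) ℝ)
    (hA : A.IsHermitian) (hB : B.IsSymm) (ℓ : ℕ) (f : Polynomial ℝ) :
    opNorm (iteratedDeriv ℓ (fun s : ℝ => (Polynomial.aeval (A + s • B) f :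
        Matrix (Fin m) (Fin m) ℝ)) 0) ≤
      (m : ℝ) ^ (ℓ + 1) *
        sSup ((fun x => |(Polynomial.derivative^[ℓ] f).eval x|) ''
          Set.Icc (⨅ i, hA.eigenvalues i) (⨆ i, hA.eigenvalues i)) *
        opNorm B ^ ℓ := by
  unfold opNorm
  rw [toEuclideanCLM_iteratedDeriv_aeval]
  have key := norm_iteratedDeriv_aeval_add_smul_le (Matrix.toEuclideanCLM (𝕜 := ℝ) B)
    hA.eigenvectorBasis.sum_rankOne_self (fun i => by simp)
    hA.rankOne_mul_toEuclideanCLM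
    (fun i => ⟨ciInf_le (Finite.bddBelow_range _) i, le_ciSup (Finite.bddAbove_range _) i⟩)
    ℓ f (fun x hx => le_csSup (isCompact_Icc.bddAbove_image
      (Polynomial.derivative^[ℓ] f).continuous.abs.continuousOn) (Set.mem_image_of_mem _ hx))
  simpa only [Fintype.card_fin] using key
end
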